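/- arXiv:1609.02695 — 4 statements merged into one kernel-verified Lean document; each statement's English description precedes it below -/
import Mathlib

section
/- Let m ≥ 1 and let μ = (μ₁, …, μ_m) be a nonzero tuple of integers with μ₁ ≥ μ₂ ≥ … ≥ μ_m ≥ 0. Then C_m(μ) ≥ 2m. -/
open Finset

/-- Weyl dimension formula `D_r` for `sl(r)`, applied to the entries
`β 0, …, β (r-1)` (0-indexed versions of `β₁, …, β_r`). -/
def slDim (r : ℕ) (β : ℕ → ℚ) : ℚ :=
  ∏ i ∈ Finset.range r, ∏ j ∈ Finset.range r,
    if i < j then ((j : ℚ) - (i : ℚ) + β i - β j) / ((j : ℚ) - (i : ℚ)) else 1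

/-- Weyl dimension formula `C_m` for `sp(2m)`. -/
def spDim (m : ℕ) (β : ℕ → ℚ) : ℚ :=
  slDim m β *
    ∏ i ∈ Finset.range m, ∏ j ∈ Finset.range m,
      if i ≤ j then
        ((2 * m : ℚ) - (i : ℚ) - (j : ℚ) + β i + β j) /
          ((2 * m : ℚ) - (i : ℚ) - (j : ℚ))
      else 1

/-- Weyl dimension formula `B_m` for `so(2m+1)`. -/
def soOddDim (m : ℕ) (β : ℕ → ℚ) : ℚ :=
  slDim m β *
    ∏ i ∈ Finset.range m, ∏ j ∈ Finset.range m,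
      if i ≤ j then
        ((2 * m : ℚ) - 1 - (i : ℚ) - (j : ℚ) + β i + β j) /
          ((2 * m : ℚ) - 1 - (i : ℚ) - (j : ℚ))
      else 1

/-- Weyl dimension formula `E_m` for `so(2m)`. -/
def soEvenDim (m : ℕ) (β : ℕ → ℚ) : ℚ :=
  slDim m β *
    ∏ i ∈ Finset.range m, ∏ j ∈ Finset.range m,
      if i < j then
        ((2 * m : ℚ) - 2 - (i : ℚ) - (j : ℚ) + β i + β j) /
          ((2 * m : ℚ) - 2 - (i : ℚ) - (j : ℚ))
      else 1

/-- The tuple determined by a list, extended by zeros. -/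
def lw (l : List ℚ) : ℕ → ℚ := fun i => l.getD i 0

/-- `β₁ + ⋯ + β_k` (the sum of the first `k` entries). -/
def headSum (k : ℕ) (β : ℕ → ℚ) : ℚ := ∑ i ∈ Finset.range k, β i

/-- A weight for the ordinary Grassmannian `Gr(k,n)`: integers
`β₁ ≥ β₂ ≥ ⋯ ≥ β_n = 0`, extended by zeros beyond position `n`. -/
def IsGrWeight (n : ℕ) (β : ℕ → ℚ) : Prop :=
  (∀ i, ∃ z : ℤ, β i = (z : ℚ)) ∧ (∀ i j, i ≤ j → β j ≤ β i) ∧ ∀ i, n - 1 ≤ i → β i = 0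

/-- `rank(β) = D_k(β₁,…,β_k) ⬝ D_{n-k}(β_{k+1},…,β_n)` on `Gr(k,n)`. -/
def grRank (k n : ℕ) (β : ℕ → ℚ) : ℚ := slDim k β * slDim (n - k) (fun i => β (k + i))

/-- `dex(β) = (|β|₁/k − |β|₂/(n−k)) ⬝ rank(β)` on `Gr(k,n)`. -/
def grDex (k n : ℕ) (β : ℕ → ℚ) : ℚ :=
  (headSum k β / (k : ℚ) -
      (∑ i ∈ Finset.range (n - k), β (k + i)) / ((n : ℚ) - (k : ℚ))) * grRank k n β

/-- A weight for the symplectic Grassmannian `IGr(k,2n)`: integers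
`β₁ ≥ ⋯ ≥ β_n ≥ 0`, extended by zeros beyond position `n`. -/
def IsIGrWeight (n : ℕ) (β : ℕ → ℚ) : Prop :=
  (∀ i, ∃ z : ℤ, β i = (z : ℚ)) ∧ (∀ i j, i ≤ j → β j ≤ β i) ∧ ∀ i, n ≤ i → β i = 0

/-- `rank(β) = D_k(β₁,…,β_k) ⬝ C_{n-k}(β_{k+1},…,β_n)` on `IGr(k,2n)`. -/
def igrRank (k n : ℕ) (β : ℕ → ℚ) : ℚ := slDim k β * spDim (n - k) (fun i => β (k + i))

/-- `dex(β) = ((β₁+⋯+β_k)/k) ⬝ rank(β)` on `IGr(k,2n)`. -/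
def igrDex (k n : ℕ) (β : ℕ → ℚ) : ℚ := headSum k β / (k : ℚ) * igrRank k n β

/-- A weight for the odd orthogonal Grassmannian `OGr(k,2n+1)`:
`β₁ ≥ ⋯ ≥ β_n ≥ 0`, all entries integers or all half-odd-integers,
extended by zeros beyond position `n`. -/
def IsOGrOddWeight (n : ℕ) (β : ℕ → ℚ) : Prop :=
  ((∀ i, i < n → ∃ z : ℤ, β i = (z : ℚ)) ∨
    (∀ i, i < n → ∃ z : ℤ, β i = (z : ℚ) + 1/2)) ∧
  (∀ i j, i ≤ j → j < n → β j ≤ β i) ∧ (∀ i, i < n → 0 ≤ β i) ∧ ∀ i, n ≤ i → β i = 0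

/-- `rank(β) = D_k(β₁,…,β_k) ⬝ B_{n-k}(β_{k+1},…,β_n)` on `OGr(k,2n+1)`. -/
def ogrOddRank (k n : ℕ) (β : ℕ → ℚ) : ℚ :=
  slDim k β * soOddDim (n - k) (fun i => β (k + i))

/-- `dex(β) = ((β₁+⋯+β_k)/k) ⬝ rank(β)` on `OGr(k,2n+1)`. -/
def ogrOddDex (k n : ℕ) (β : ℕ → ℚ) : ℚ := headSum k β / (k : ℚ) * ogrOddRank k n β

/-- A weight for the even orthogonal Grassmannian `OGr(k,2n)`:
`β₁ ≥ ⋯ ≥ β_{n-1} ≥ |β_n|`, all entries integers or all half-odd-integers,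
extended by zeros beyond position `n`. -/
def IsOGrEvenWeight (n : ℕ) (β : ℕ → ℚ) : Prop :=
  ((∀ i, i < n → ∃ z : ℤ, β i = (z : ℚ)) ∨
    (∀ i, i < n → ∃ z : ℤ, β i = (z : ℚ) + 1/2)) ∧
  (∀ i j, i ≤ j → j + 1 < n → β j ≤ β i) ∧
  (∀ i, i + 1 < n → |β (n - 1)| ≤ β i) ∧ ∀ i, n ≤ i → β i = 0

/-- `rank(β) = D_k(β₁,…,β_k) ⬝ E_{n-k}(β_{k+1},…,β_n)` on `OGr(k,2n)`. -/
def ogrEvenRank (k n : ℕ) (β : ℕ → ℚ) : ℚ :=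
  slDim k β * soEvenDim (n - k) (fun i => β (k + i))

/-- `dex(β) = ((β₁+⋯+β_k)/k) ⬝ rank(β)` on `OGr(k,2n)`. -/
def ogrEvenDex (k n : ℕ) (β : ℕ → ℚ) : ℚ := headSum k β / (k : ℚ) * ogrEvenRank k n β

/-- Replace the last entry `β_n` by its negative. -/
def negLast (n : ℕ) (β : ℕ → ℚ) : ℕ → ℚ := fun i => if i = n - 1 then -β i else β i

/-- The contribution to `spDim (m + 1)` of the positive roots involving the first coordinate. -/
def spRow (m : ℕ) (x : ℚ) (β : ℕ → ℚ) : ℚ :=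
  (2 * (m + 1) + 2 * x) / (2 * (m + 1)) *
    ∏ j ∈ range m, ((j + 1 + x - β j) / (j + 1) *
      ((2 * (m + 1) - (j + 1) + x + β j) / (2 * (m + 1) - (j + 1))))

theorem spDim_succ (m : ℕ) (β : ℕ → ℚ) :
    spDim (m + 1) β = spRow m (β 0) (fun i => β (i + 1)) * spDim m (fun i => β (i + 1)) := by
  have h : ∀ i j : ℕ, (2 * ((m : ℚ) + 1) - (i + 1) - (j + 1)) = 2 * m - i - j := by
    intros; ring
  simp only [spDim, slDim, spRow, prod_range_succ', Nat.cast_add, Nat.cast_one, Nat.cast_zero,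
    add_lt_add_iff_right, add_le_add_iff_right, add_sub_add_right_eq_sub, h, prod_mul_distrib,
    Nat.not_lt_zero, if_true, if_false, prod_const_one, Nat.succ_pos,
    Nat.le_zero, Nat.succ_ne_zero, Nat.zero_le, sub_zero, mul_one, ← two_mul, add_assoc]
  ring

theorem spDim_eq_one_of_eq_zero {m : ℕ} {β : ℕ → ℚ} (h : ∀ i < m, β i = 0) :
    spDim m β = 1 := by
  unfold spDim slDim
  rw [prod_eq_one, prod_eq_one, one_mul]
  · intro i hi
    refine prod_eq_one fun j hj => ?_
    rw [mem_range] at hi hj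
    have hi' : (i : ℚ) < m := by exact_mod_cast hi
    have hj' : (j : ℚ) < m := by exact_mod_cast hj
    rw [h i hi, h j hj, add_zero, add_zero, div_self (by linarith), ite_self]
  · intro i hi
    refine prod_eq_one fun j hj => ?_
    rw [mem_range] at hi hj
    split_ifs with hij
    · have hij' : (i : ℚ) < j := by exact_mod_cast hij
      rw [h i hi, h j hj, add_zero, sub_zero, div_self (by linarith)]
    · rfl

theorem prod_range_sub_add_two_div_sub (n : ℕ) (c : ℚ) (hc : n < c) :
    ∏ j ∈ range n, (c - (j + 1) + 2) / (c - (j + 1)) =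
      (c + 1) * c / ((c - n + 1) * (c - n)) := by
  induction n with
  | zero =>
    have h : 0 < c := by simpa using hc
    rw [prod_range_zero, Nat.cast_zero, sub_zero, div_self (by positivity)]
  | succ n ih =>
    push_cast at hc ⊢
    rw [prod_range_succ, ih (by linarith)]
    have h0 : c - n ≠ 0 := by linarith
    have h1 : c - n + 1 ≠ 0 := by linarith
    have h2 : c - (n + 1) ≠ 0 := by linarith
    have h3 : c - (n + 1) + 1 ≠ 0 := by linarith
    field_simp
    ring

theorem prod_range_add_two_div_mul_sub_div (n : ℕ) (c : ℚ) (hc : n < c) :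
    ∏ j ∈ range n, (((j : ℚ) + 2) / (j + 1) * ((c - (j + 1) + 1) / (c - (j + 1)))) =
      (n + 1) * c / (c - n) := by
  induction n with
  | zero =>
    have h : 0 < c := by simpa using hc
    rw [prod_range_zero, Nat.cast_zero, sub_zero, zero_add, one_mul, div_self h.ne']
  | succ n ih =>
    push_cast at hc ⊢
    rw [prod_range_succ, ih (by linarith)]
    have h0 : c - n ≠ 0 := by linarith
    have h1 : (n : ℚ) + 1 ≠ 0 := by positivity
    have h2 : c - (n + 1) ≠ 0 := by linarith
    field_simp
    ring

theorem two_le_spRow (m : ℕ) {x : ℚ} {β : ℕ → ℚ} (hx : 1 ≤ x) (h0 : ∀ i < m, 0 ≤ β i)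
    (hβ : ∀ i < m, β i ≤ x) : 2 ≤ spRow m x β := by
  have hm : (0 : ℚ) ≤ m := m.cast_nonneg
  have hprod : ∏ j ∈ range m, (2 * ((m : ℚ) + 1) - (j + 1) + 2) / (2 * (m + 1) - (j + 1)) ≤
      ∏ j ∈ range m, (((j : ℚ) + 1 + x - β j) / (j + 1) *
        ((2 * (m + 1) - (j + 1) + x + β j) / (2 * (m + 1) - (j + 1)))) := by
    refine prod_le_prod (fun j hj => ?_) fun j hj => ?_
    all_goals
      rw [mem_range] at hj
      have hj' : (j : ℚ) < m := by exact_mod_cast hj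
      have hp : 0 < 2 * ((m : ℚ) + 1) - (j + 1) := by linarith
    · positivity
    · have hq : (0 : ℚ) < j + 1 := by positivity
      rw [div_mul_div_comm, div_le_div_iff₀ hp (by positivity)]
      have key : (2 * ((m : ℚ) + 1) - (j + 1) + 2) * (j + 1) ≤
          (j + 1 + x - β j) * (2 * (m + 1) - (j + 1) + x + β j) := by
        have hb := h0 j hj
        have hbx := hβ j hj
        nlinarith [mul_nonneg (sub_nonneg.2 hbx)
          (by linarith : 0 ≤ 2 * ((m : ℚ) + 1) - 2 * (j + 1) + x + β j),
          mul_nonneg hq.le (sub_nonneg.2 hx)]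
      nlinarith [mul_le_mul_of_nonneg_right key hp.le]
  rw [prod_range_sub_add_two_div_sub m _ (by linarith)] at hprod
  have hfirst : (2 * ((m : ℚ) + 1) + 2) / (2 * (m + 1)) ≤
      (2 * (m + 1) + 2 * x) / (2 * (m + 1)) := by
    gcongr
    linarith
  have hD : (0 : ℚ) < (2 * (m + 1) - m + 1) * (2 * (m + 1) - m) := by
    apply mul_pos <;> linarith
  refine le_trans ?_ (mul_le_mul hfirst hprod (by positivity) (by positivity))
  rw [div_mul_div_comm, le_div_iff₀ (by positivity)]
  nlinarith [mul_nonneg hm hm, mul_nonneg (mul_nonneg hm hm) hm]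

theorem le_spRow_of_eq_zero (m : ℕ) {x : ℚ} {β : ℕ → ℚ} (hx : 1 ≤ x) (hβ : ∀ i < m, β i = 0) :
    2 * ((m : ℚ) + 1) ≤ spRow m x β := by
  have hm : (0 : ℚ) ≤ m := m.cast_nonneg
  have hprod : ∏ j ∈ range m, (((j : ℚ) + 2) / (j + 1) *
        ((2 * ((m : ℚ) + 1) - (j + 1) + 1) / (2 * (m + 1) - (j + 1)))) ≤
      ∏ j ∈ range m, (((j : ℚ) + 1 + x - β j) / (j + 1) *
        ((2 * (m + 1) - (j + 1) + x + β j) / (2 * (m + 1) - (j + 1)))) := by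
    refine prod_le_prod (fun j hj => ?_) fun j hj => ?_
    all_goals
      rw [mem_range] at hj
      have hj' : (j : ℚ) < m := by exact_mod_cast hj
      have hp : 0 < 2 * ((m : ℚ) + 1) - (j + 1) := by linarith
    · positivity
    · rw [hβ j hj, sub_zero, add_zero]
      gcongr ?_ / _ * (?_ / _) <;> linarith
  rw [prod_range_add_two_div_mul_sub_div m _ (by linarith)] at hprod
  have hfirst : (2 * ((m : ℚ) + 1) + 2) / (2 * (m + 1)) ≤
      (2 * (m + 1) + 2 * x) / (2 * (m + 1)) := by
    gcongr
    linarith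
  have hD : (0 : ℚ) < 2 * (m + 1) - m := by linarith
  refine le_trans ?_ (mul_le_mul hfirst hprod (by positivity) (by positivity))
  rw [div_mul_div_comm, le_div_iff₀ (by positivity)]
  apply le_of_eq
  ring

/-- For a nonzero weakly decreasing tuple `μ₁ ≥ ⋯ ≥ μ_m ≥ 0` of integers,
`C_m(μ) ≥ 2m`. -/
theorem stmt10 (m : ℕ) (hm : 1 ≤ m) (μ : ℕ → ℤ)
    (hdec : ∀ i j, i ≤ j → j < m → μ j ≤ μ i)
    (hnn : ∀ i, i < m → 0 ≤ μ i)
    (hnz : ∃ i, i < m ∧ μ i ≠ 0) :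
    (2 * m : ℚ) ≤ spDim m (fun i => (μ i : ℚ)) := by
  clear hm
  induction m generalizing μ with
  | zero =>
    obtain ⟨i, hi, -⟩ := hnz
    exact absurd hi i.not_lt_zero
  | succ m ih =>
    have hx : (1 : ℚ) ≤ (μ 0 : ℚ) := by
      obtain ⟨i, hi, hne⟩ := hnz
      have h1 := hdec 0 i i.zero_le hi
      have h2 := hnn i hi
      exact_mod_cast (by omega : 1 ≤ μ 0)
    rw [spDim_succ, Nat.cast_succ]
    by_cases hz : ∀ i < m, μ (i + 1) = 0
    · have hz' : ∀ i < m, (μ (i + 1) : ℚ) = 0 := fun i hi => by rw [hz i hi, Int.cast_zero]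
      rw [spDim_eq_one_of_eq_zero hz', mul_one]
      exact le_spRow_of_eq_zero m hx hz'
    · push Not at hz
      have hrec := ih (fun i => μ (i + 1))
        (fun i j hij hj => hdec _ _ (Nat.succ_le_succ hij) (Nat.succ_lt_succ hj))
        (fun i hi => hnn _ (Nat.succ_lt_succ hi)) hz
      have hrow : 2 ≤ spRow m (μ 0 : ℚ) (fun i => (μ (i + 1) : ℚ)) :=
        two_le_spRow m hx (fun i hi => by exact_mod_cast hnn _ (Nat.succ_lt_succ hi))
          fun i hi => by exact_mod_cast hdec 0 _ (Nat.zero_le _) (Nat.succ_lt_succ hi)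
      have hm : (1 : ℚ) ≤ m := by
        obtain ⟨i, hi, -⟩ := hz
        exact_mod_cast (by omega : 1 ≤ m)
      nlinarith [mul_le_mul hrow hrec (by positivity) (by linarith)]
end

section
/- Let n ≥ 3 and let β = (β₁, …, β_n) be a tuple of integers with β₁ ≥ β₂ ≥ … ≥ β_n ≥ 0. If β₁ > β₂ and (β₃, …, β_n) ≠ (0, …, 0), then (β₁ − β₂ + 1) · C_{n−2}(β₃, …, β_n) ≥ 4(n − 2). (This says that an irreducible homogeneous globally generated bundle on the symplectic Grassmannian IGr(2,2n) whose sl(2)-part is not a multiple of the determinant and whose sp(2n−4)-part is nontrivial has rank at least 4n − 8.) -/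
open Finset

theorem mul_four_le_mul_four {a b c d a' b' c' d' : ℚ} (ha : 0 ≤ a) (hb : 0 ≤ b) (hc : 0 ≤ c)
    (hd : 0 ≤ d) (haa : a ≤ a') (hbb : b ≤ b') (hcc : c ≤ c') (hdd : d ≤ d') :
    a * b * c * d ≤ a' * b' * c' * d' := by
  have := ha.trans haa
  have := hb.trans hbb
  have := hc.trans hcc
  gcongr

theorem slDim_succ (r : ℕ) (β : ℕ → ℚ) :
    slDim (r + 1) β =
      (∏ j ∈ range r, ((j : ℚ) + 1 + β 0 - β (j + 1)) / ((j : ℚ) + 1)) *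
        slDim r (fun i => β (i + 1)) := by
  simp only [slDim]
  rw [prod_range_succ', mul_comm]
  congr 1
  · rw [prod_range_succ']
    simp
  · refine prod_congr rfl fun i _ => ?_
    rw [prod_range_succ']
    simp

/-- Recursion for the symplectic dimension formula: split off the factors of the positive roots
involving the first coordinate. -/
theorem spDim_succ_s11 (r : ℕ) (β : ℕ → ℚ) :
    spDim (r + 1) β =
      (∏ j ∈ range r, ((j : ℚ) + 1 + β 0 - β (j + 1)) / ((j : ℚ) + 1)) *
        (∏ j ∈ range r, ((2 * r + 2 : ℚ) - (j + 1) + β 0 + β (j + 1)) /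
          ((2 * r + 2 : ℚ) - (j + 1))) *
        (((2 * r + 2 : ℚ) + β 0 + β 0) / (2 * r + 2)) * spDim r (fun i => β (i + 1)) := by
  have key : (∏ i ∈ range (r + 1), ∏ j ∈ range (r + 1),
      if i ≤ j then
        ((2 * (r + 1 : ℕ) : ℚ) - (i : ℚ) - (j : ℚ) + β i + β j) /
          ((2 * (r + 1 : ℕ) : ℚ) - (i : ℚ) - (j : ℚ))
      else 1) =
      ((∏ j ∈ range r, ((2 * r + 2 : ℚ) - (j + 1) + β 0 + β (j + 1)) /
          ((2 * r + 2 : ℚ) - (j + 1))) *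
        (((2 * r + 2 : ℚ) + β 0 + β 0) / (2 * r + 2))) *
      ∏ i ∈ range r, ∏ j ∈ range r,
        if i ≤ j then
          ((2 * r : ℚ) - (i : ℚ) - (j : ℚ) + β (i + 1) + β (j + 1)) /
            ((2 * r : ℚ) - (i : ℚ) - (j : ℚ))
        else 1 := by
    rw [prod_range_succ', mul_comm]
    congr 1
    · rw [prod_range_succ']
      simp [mul_add]
    · refine prod_congr rfl fun i _ => ?_
      rw [prod_range_succ']
      simp only [nonpos_iff_eq_zero, Nat.add_eq_zero_iff, one_ne_zero, and_false, if_false,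
        mul_one, add_le_add_iff_right]
      refine prod_congr rfl fun j _ => ?_
      push_cast
      ring_nf
  rw [spDim, key, slDim_succ, spDim]
  ring

theorem prod_range_add_two_div_add_one (r : ℕ) :
    ∏ j ∈ range r, ((j : ℚ) + 1 + 1) / ((j : ℚ) + 1) = r + 1 := by
  induction r with
  | zero => simp
  | succ r ih =>
    rw [prod_range_succ, ih]
    push_cast
    field_simp

theorem prod_range_sub_add_one_div_sub (c : ℚ) (t : ℕ) (h : (t : ℚ) < c) :
    ∏ j ∈ range t, (c - (j + 1) + 1) / (c - (j + 1)) = c / (c - t) := by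
  induction t with
  | zero =>
    have : c ≠ 0 := by
      rintro rfl
      simp at h
    simp [this]
  | succ t ih =>
    push_cast at h
    have h₁ : c - t ≠ 0 := by linarith
    have h₂ : c - (t + 1) ≠ 0 := by linarith
    rw [prod_range_succ, ih (by linarith)]
    push_cast
    field_simp
    ring

theorem one_le_prod_slRow (r : ℕ) (μ : ℕ → ℚ) (hdec : ∀ i j, i ≤ j → j < r + 1 → μ j ≤ μ i) :
    1 ≤ ∏ j ∈ range r, ((j : ℚ) + 1 + μ 0 - μ (j + 1)) / ((j : ℚ) + 1) := by
  refine Finset.one_le_prod fun j hj => ?_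
  have := hdec 0 (j + 1) (by omega) (by simpa using hj)
  rw [one_le_div (by positivity)]
  linarith

theorem one_le_spRow_factor {r j : ℕ} (hj : j < r) {x y : ℚ} (hx : 0 ≤ x) (hy : 0 ≤ y) :
    1 ≤ ((2 * r + 2 : ℚ) - (j + 1) + x + y) / ((2 * r + 2 : ℚ) - (j + 1)) := by
  have : (j : ℚ) < r := by exact_mod_cast hj
  rw [one_le_div (by linarith)]
  linarith

theorem one_le_spDim (m : ℕ) (μ : ℕ → ℚ) (hdec : ∀ i j, i ≤ j → j < m → μ j ≤ μ i)
    (hnn : ∀ i, i < m → 0 ≤ μ i) : 1 ≤ spDim m μ := by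
  induction m generalizing μ with
  | zero => simp [spDim, slDim]
  | succ r ih =>
    have h₀ := hnn 0 (by omega)
    rw [spDim_succ_s11]
    refine one_le_mul_of_one_le_of_one_le (one_le_mul_of_one_le_of_one_le
      (one_le_mul_of_one_le_of_one_le (one_le_prod_slRow r μ hdec) ?_) ?_) ?_
    · refine Finset.one_le_prod fun j hj => ?_
      have hj := mem_range.1 hj
      exact one_le_spRow_factor hj h₀ (hnn _ (by omega))
    · rw [one_le_div (by positivity)]
      linarith
    · exact ih _ (fun i j hij hj => hdec _ _ (by omega) (by omega))
        fun i hi => hnn _ (by omega)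

/-- A nontrivial irreducible representation of `sp(2m)` has dimension at least `2m`. -/
theorem two_mul_le_spDim (m : ℕ) (μ : ℕ → ℚ) (hdec : ∀ i j, i ≤ j → j < m → μ j ≤ μ i)
    (hint : ∀ i, i < m → μ i = 0 ∨ 1 ≤ μ i) (hnz : ∃ i, i < m ∧ μ i ≠ 0) :
    2 * (m : ℚ) ≤ spDim m μ := by
  induction m generalizing μ with
  | zero => simp at hnz
  | succ r ih =>
    have hnn : ∀ i, i < r + 1 → 0 ≤ μ i := fun i hi => by
      rcases hint i hi with h | h <;> linarith
    obtain ⟨k, hk, hk0⟩ := hnz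
    have h₀ : 1 ≤ μ 0 :=
      ((hint k hk).resolve_left hk0).trans (hdec 0 k (by omega) hk)
    have hdec' : ∀ i j, i ≤ j → j < r → μ (j + 1) ≤ μ (i + 1) :=
      fun i j hij hj => hdec _ _ (by omega) (by omega)
    have hlong : ((2 * r + 2 : ℚ) + 1 + 1) / (2 * r + 2) ≤
        ((2 * r + 2 : ℚ) + μ 0 + μ 0) / (2 * r + 2) := by
      gcongr
    rw [spDim_succ_s11]
    by_cases htail : ∃ i, i < r ∧ μ (i + 1) ≠ 0
    · have hrec := ih (fun i => μ (i + 1)) hdec' (fun i hi => hint _ (by omega)) htail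
      obtain ⟨i, hi, hi0⟩ := htail
      have h₁ : 1 ≤ μ 1 :=
        ((hint (i + 1) (by omega)).resolve_left hi0).trans (hdec 1 (i + 1) (by omega) (by omega))
      obtain ⟨s, rfl⟩ : ∃ s, r = s + 1 := ⟨r - 1, by omega⟩
      have hsl := one_le_prod_slRow (s + 1) μ hdec
      have hsp : (2 * (s : ℚ) + 5) / (2 * s + 3) ≤
          ∏ j ∈ range (s + 1), ((2 * (s + 1 : ℕ) + 2 : ℚ) - (j + 1) + μ 0 + μ (j + 1)) /
            ((2 * (s + 1 : ℕ) + 2 : ℚ) - (j + 1)) := by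
        rw [prod_range_succ']
        have hone : 1 ≤ ∏ j ∈ range s,
            ((2 * (s + 1 : ℕ) + 2 : ℚ) - ((j + 1 : ℕ) + 1) + μ 0 + μ (j + 1 + 1)) /
              ((2 * (s + 1 : ℕ) + 2 : ℚ) - ((j + 1 : ℕ) + 1)) := by
          refine Finset.one_le_prod fun j hj => ?_
          have hj := mem_range.1 hj
          exact one_le_spRow_factor (by omega) (by linarith) (hnn _ (by omega))
        refine le_trans ?_ (le_mul_of_one_le_left ?_ hone)
        · push_cast
          rw [div_le_div_iff₀ (by positivity) (by linarith)]
          nlinarith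
        · exact zero_le_one.trans
            (one_le_spRow_factor (by omega) (by linarith) (hnn _ (by omega)))
      have hnum : 2 * ((s + 1 + 1 : ℕ) : ℚ) ≤
          1 * ((2 * (s : ℚ) + 5) / (2 * s + 3)) *
            (((2 * (s + 1 : ℕ) + 2 : ℚ) + 1 + 1) / (2 * (s + 1 : ℕ) + 2)) *
            (2 * (s + 1 : ℕ)) := by
        push_cast
        field_simp
        ring_nf
        nlinarith [sq_nonneg (s : ℚ), pow_nonneg (Nat.cast_nonneg s : (0 : ℚ) ≤ s) 3]
      exact hnum.trans (mul_four_le_mul_four zero_le_one (by positivity) (by positivity)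
        (by positivity) hsl hsp hlong hrec)
    · push Not at htail
      have hsl : (r : ℚ) + 1 ≤
          ∏ j ∈ range r, ((j : ℚ) + 1 + μ 0 - μ (j + 1)) / ((j : ℚ) + 1) := by
        rw [← prod_range_add_two_div_add_one]
        refine prod_le_prod (fun j _ => by positivity) fun j hj => ?_
        rw [htail j (mem_range.1 hj), sub_zero]
        gcongr
      have hsp : (2 * r + 2 : ℚ) / ((2 * r + 2) - r) ≤
          ∏ j ∈ range r, ((2 * r + 2 : ℚ) - (j + 1) + μ 0 + μ (j + 1)) /
            ((2 * r + 2 : ℚ) - (j + 1)) := by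
        rw [← prod_range_sub_add_one_div_sub _ _ (by linarith [Nat.cast_nonneg (α := ℚ) r])]
        have hpos : ∀ j ∈ range r, (0 : ℚ) < (2 * r + 2 : ℚ) - (j + 1) := fun j hj => by
          have : (j : ℚ) < r := by exact_mod_cast mem_range.1 hj
          linarith
        refine prod_le_prod (fun j hj => ?_) fun j hj => ?_
        · have := hpos j hj
          positivity
        · have := hpos j hj
          rw [htail j (mem_range.1 hj), add_zero]
          gcongr
      have hrest := one_le_spDim r (fun i => μ (i + 1)) hdec' fun i hi => hnn _ (by omega)
      have hden : (0 : ℚ) < (2 * r + 2) - r := by linarith [Nat.cast_nonneg (α := ℚ) r]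
      have hnum : 2 * ((r + 1 : ℕ) : ℚ) =
          ((r : ℚ) + 1) * ((2 * r + 2 : ℚ) / ((2 * r + 2) - r)) *
            (((2 * r + 2 : ℚ) + 1 + 1) / (2 * r + 2)) * 1 := by
        rw [show (2 * r + 2 : ℚ) - r = r + 2 by ring]
        push_cast
        field_simp
        ring
      rw [hnum]
      exact mul_four_le_mul_four (by positivity) (by positivity) (by positivity) zero_le_one
        hsl hsp hlong hrest

/-- For integers `β₁ ≥ ⋯ ≥ β_n ≥ 0` with `β₁ > β₂` and `(β₃,…,β_n) ≠ 0`,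
`(β₁ − β₂ + 1) ⬝ C_{n−2}(β₃,…,β_n) ≥ 4(n − 2)`. -/
theorem stmt11 (n : ℕ) (hn : 3 ≤ n) (β : ℕ → ℤ)
    (hdec : ∀ i j, i ≤ j → j < n → β j ≤ β i)
    (hnn : ∀ i, i < n → 0 ≤ β i)
    (h12 : β 1 < β 0)
    (hnz : ∃ i, 2 ≤ i ∧ i < n ∧ β i ≠ 0) :
    4 * ((n : ℚ) - 2) ≤
      ((β 0 : ℚ) - (β 1 : ℚ) + 1) * spDim (n - 2) (fun i => (β (2 + i) : ℚ)) := by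
  have hm : ((n - 2 : ℕ) : ℚ) = (n : ℚ) - 2 := by
    rw [Nat.cast_sub (by omega)]
    norm_num
  obtain ⟨k, hk2, hkn, hk0⟩ := hnz
  have hsp := two_mul_le_spDim (n - 2) (fun i => (β (2 + i) : ℚ))
    (fun i j hij hj => by exact_mod_cast hdec _ _ (by omega) (by omega))
    (fun i hi => by
      have := hnn (2 + i) (by omega)
      rcases this.eq_or_lt with h | h
      · exact Or.inl (by exact_mod_cast h.symm)
      · exact Or.inr (by exact_mod_cast h))
    ⟨k - 2, by omega, by
      have : 2 + (k - 2) = k := by omega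
      simpa [this] using hk0⟩
  have hsl : (2 : ℚ) ≤ (β 0 : ℚ) - (β 1 : ℚ) + 1 := by
    have : (β 1 : ℚ) + 1 ≤ β 0 := by exact_mod_cast h12
    linarith
  rw [hm] at hsp
  have hn' : (3 : ℚ) ≤ n := by exact_mod_cast hn
  calc 4 * ((n : ℚ) - 2) = 2 * (2 * ((n : ℚ) - 2)) := by ring
    _ ≤ _ := mul_le_mul hsl hsp (by linarith) (by linarith)
end

section
/- (Classification of fourfolds with trivial canonical bundle in symplectic Grassmannians.) Let n ≥ 3 and 2 ≤ k ≤ n−1, and let β¹, …, β^m be nonzero weights for IGr(k,2n) such that: at least one β^i has (β^i_{k+1}, …, β^i_n) ≠ (0,…,0); at most one β^i equals (1,0,…,0); ∑_i rank(β^i) = k(2n−k) − k(k−1)/2 − 4; and ∑_i dex(β^i) = 2n − k + 1. Then, up to reordering, (k, n, (β¹,…,β^m)) is one of the following ten: (1) k=2, n=3: (1,1,1), (3,3,0); (2) k=2, n=3: (2,2,1), (1,1,0); (3) k=2, n=4: (1,1,1,1), (1,1,0,0), (1,1,0,0); (4) k=2, n=4: (1,1,1,0), (1,1,0,0), (1,1,0,0),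 (1,1,0,0); (5) k=2, n=4: (1,1,1,0), (1,0,0,0), (2,2,0,0); (6) k=2, n=4: (1,1,1,0), (2,0,0,0); (7) k=3, n=4: (1,1,1,1), (1,1,0,0), (1,1,0,0); (8) k=3, n=4: (1,1,1,1), (2,0,0,0); (9) k=3, n=4: (1,1,1,1), (1,0,0,0), (1,1,1,0), (1,1,1,0), (1,1,1,0); (10) k=3, n=4: (1,1,1,1), (1,1,1,1), (1,0,0,0), (1,1,1,0). -/
open Finset

theorem one_le_slDim (r : ℕ) {β : ℕ → ℚ} (hβ : Antitone β) : 1 ≤ slDim r β := by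
  unfold slDim
  refine Finset.prod_induction _ (fun x : ℚ => 1 ≤ x)
    (fun _ _ => one_le_mul_of_one_le_of_one_le) le_rfl fun i _ =>
    Finset.prod_induction _ (fun x : ℚ => 1 ≤ x)
      (fun _ _ => one_le_mul_of_one_le_of_one_le) le_rfl fun j _ => ?_
  split_ifs with hij
  · have h1 : (i : ℚ) < j := by exact_mod_cast hij
    have h2 := hβ hij.le
    rw [one_le_div (by linarith)]
    linarith
  · exact le_rfl

theorem one_le_spDim_s12 (m : ℕ) {β : ℕ → ℚ} (hβ : Antitone β) (h0 : ∀ i, 0 ≤ β i) :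
    1 ≤ spDim m β := by
  unfold spDim
  refine one_le_mul_of_one_le_of_one_le (one_le_slDim m hβ) <|
    Finset.prod_induction _ (fun x : ℚ => 1 ≤ x)
      (fun _ _ => one_le_mul_of_one_le_of_one_le) le_rfl fun i hi =>
    Finset.prod_induction _ (fun x : ℚ => 1 ≤ x)
      (fun _ _ => one_le_mul_of_one_le_of_one_le) le_rfl fun j hj => ?_
  have h1 : (i : ℚ) < m := by exact_mod_cast Finset.mem_range.1 hi
  have h2 : (j : ℚ) < m := by exact_mod_cast Finset.mem_range.1 hj
  split_ifs
  · rw [one_le_div (by linarith)]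
    linarith [h0 i, h0 j]
  · exact le_rfl

theorem slDim_zero (r : ℕ) : slDim r (fun _ => 0) = 1 := by
  refine Finset.prod_eq_one fun i _ => Finset.prod_eq_one fun j _ => ?_
  split_ifs with hij
  · have h1 : (i : ℚ) < j := by exact_mod_cast hij
    rw [add_zero, sub_zero, div_self (by linarith)]
  · rfl

theorem spDim_zero (m : ℕ) : spDim m (fun _ => 0) = 1 := by
  unfold spDim
  rw [slDim_zero, one_mul]
  refine Finset.prod_eq_one fun i hi => Finset.prod_eq_one fun j hj => ?_
  have h1 : (i : ℚ) < m := by exact_mod_cast Finset.mem_range.1 hi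
  have h2 : (j : ℚ) < m := by exact_mod_cast Finset.mem_range.1 hj
  split_ifs
  · rw [add_zero, add_zero, div_self (by linarith)]
  · rfl

theorem slDim_lw_one (r : ℕ) : slDim (r + 1) (lw [1]) = r + 1 := by
  unfold slDim
  rw [Finset.prod_range_succ', Finset.prod_eq_one, one_mul]
  · induction r with
    | zero => simp
    | succ r ih =>
      rw [Finset.prod_range_succ, ih]
      have : (r : ℚ) + 1 ≠ 0 := by positivity
      simp [lw]
      field_simp
  · intro i _
    refine Finset.prod_eq_one fun j _ => ?_
    split_ifs with hij
    · obtain ⟨j, rfl⟩ : ∃ l, j = l + 1 := ⟨j - 1, by omega⟩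
      have h1 : ((i + 1 : ℕ) : ℚ) < (j + 1 : ℕ) := by exact_mod_cast hij
      have h2 : ∀ l, lw [1] (l + 1) = 0 := fun l => by simp [lw]
      rw [h2, h2, add_zero, sub_zero, div_self (by linarith)]
    · rfl

theorem igrRank_lw_one {k : ℕ} (n : ℕ) (hk : 1 ≤ k) : igrRank k n (lw [1]) = k := by
  obtain ⟨r, rfl⟩ : ∃ r, k = r + 1 := ⟨k - 1, by omega⟩
  have h : (fun i => lw [1] (r + 1 + i)) = fun _ => 0 := by
    funext i
    rw [show r + 1 + i = (r + i) + 1 by ring]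
    simp [lw]
  rw [igrRank, h, spDim_zero, slDim_lw_one]
  push_cast
  ring

theorem headSum_lw_one {k : ℕ} (hk : 1 ≤ k) : headSum k (lw [1]) = 1 := by
  obtain ⟨r, rfl⟩ : ∃ r, k = r + 1 := ⟨k - 1, by omega⟩
  rw [headSum, Finset.sum_range_succ']
  simp [lw]

namespace IsIGrWeight

variable {n : ℕ} {β : ℕ → ℚ}

theorem exists_nat (h : IsIGrWeight n β) :
    ∃ f : ℕ → ℕ, Antitone f ∧ (∀ i, n ≤ i → f i = 0) ∧ β = fun i => (f i : ℚ) := by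
  obtain ⟨hz, hanti, h0⟩ := h
  have hnn : ∀ i, 0 ≤ β i := fun i => by
    rw [← h0 (max i n) (le_max_right _ _)]
    exact hanti _ _ (le_max_left _ _)
  have hN : ∀ i, ∃ a : ℕ, β i = a := fun i => by
    obtain ⟨z, hz⟩ := hz i
    have h1 : 0 ≤ z := by
      have := hnn i
      rw [hz] at this
      exact_mod_cast this
    exact ⟨z.toNat, by rw [hz]; exact_mod_cast (Int.toNat_of_nonneg h1).symm⟩
  choose f hf using hN
  refine ⟨f, fun i j hij => ?_, fun i hi => ?_, funext hf⟩
  · have := hanti i j hij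
    rw [hf, hf] at this
    exact_mod_cast this
  · have := h0 i hi
    rw [hf] at this
    exact_mod_cast this

theorem one_le_igrRank (h : IsIGrWeight n β) (k : ℕ) : 1 ≤ igrRank k n β := by
  obtain ⟨f, hf, -, rfl⟩ := h.exists_nat
  refine one_le_mul_of_one_le_of_one_le (one_le_slDim _ fun i j hij => ?_)
    (one_le_spDim_s12 _ (fun i j hij => ?_) fun i => ?_)
  · exact_mod_cast hf hij
  · have := hf (show k + i ≤ k + j by omega)
    simpa using this
  · positivity

theorem one_le_apply_zero (h : IsIGrWeight n β) (h0 : β ≠ 0) : 1 ≤ β 0 := by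
  obtain ⟨f, hf, -, rfl⟩ := h.exists_nat
  by_contra! hc
  refine h0 (funext fun i => ?_)
  have h1 : f 0 < 1 := by exact_mod_cast hc
  have := hf (Nat.zero_le i)
  simp only [Pi.zero_apply, Nat.cast_eq_zero]
  omega

theorem two_le_headSum (h : IsIGrWeight n β) (h0 : β ≠ 0) (h1 : β ≠ lw [1]) {k : ℕ}
    (hk : 2 ≤ k) : 2 ≤ headSum k β := by
  have hf0 := h.one_le_apply_zero h0
  obtain ⟨f, hf, -, rfl⟩ := h.exists_nat
  have hf0 : 1 ≤ f 0 := Nat.one_le_cast.1 hf0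
  have hf1 : 2 ≤ f 0 + f 1 := by
    by_contra hc
    refine h1 (funext fun i => ?_)
    rcases i with _ | i
    · simp [lw]
      omega
    · have := hf (show 1 ≤ i + 1 by omega)
      simp [lw]
      omega
  obtain ⟨r, rfl⟩ : ∃ r, k = r + 2 := ⟨k - 2, by omega⟩
  rw [headSum, Finset.sum_range_succ', Finset.sum_range_succ']
  have : (0 : ℚ) ≤ ∑ i ∈ Finset.range r, (f (i + 1 + 1) : ℚ) := by positivity
  have : (2 : ℚ) ≤ f 0 + f 1 := by exact_mod_cast hf1
  simp only [zero_add]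
  linarith

theorem le_headSum (h : IsIGrWeight n β) {k j : ℕ} (hkj : k ≤ j) (hj : β j ≠ 0) :
    (k : ℚ) ≤ headSum k β := by
  obtain ⟨f, hf, -, rfl⟩ := h.exists_nat
  have hfj : f j ≠ 0 := by simpa using hj
  have : ∑ i ∈ Finset.range k, (1 : ℚ) ≤ headSum k fun i => (f i : ℚ) := by
    refine Finset.sum_le_sum fun i hi => ?_
    have := hf (show i ≤ j by have := Finset.mem_range.1 hi; omega)
    exact_mod_cast (show 1 ≤ f i by omega)
  simpa using this

end IsIGrWeight

/-- `k • dex − 2 • rank`, which is nonnegative except on the weight `(1,0,…,0)`. -/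
def excess (k n : ℕ) (β : ℕ → ℚ) : ℚ := (headSum k β - 2) * igrRank k n β

theorem excess_lw_one {k : ℕ} (n : ℕ) (hk : 1 ≤ k) : excess k n (lw [1]) = -k := by
  rw [excess, headSum_lw_one hk, igrRank_lw_one n hk]
  ring

theorem excess_nonneg {k n : ℕ} (hk : 2 ≤ k) {β : ℕ → ℚ} (h : IsIGrWeight n β) (h0 : β ≠ 0)
    (h1 : β ≠ lw [1]) : 0 ≤ excess k n β :=
  mul_nonneg (by linarith [h.two_le_headSum h0 h1 hk]) (by linarith [h.one_le_igrRank k])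

theorem sum_excess {k n : ℕ} (hk : 2 ≤ k) (S : Multiset (ℕ → ℚ)) :
    (S.map (excess k n)).sum =
      k * (S.map (igrDex k n)).sum - 2 * (S.map (igrRank k n)).sum := by
  rw [← Multiset.sum_map_mul_left, ← Multiset.sum_map_mul_left, ← Multiset.sum_map_sub]
  refine congrArg Multiset.sum (Multiset.map_congr rfl fun β _ => ?_)
  have : (k : ℚ) ≠ 0 := by positivity
  rw [excess, igrDex]
  field_simp

theorem neg_le_sum_excess {k n : ℕ} (hk : 2 ≤ k) {S : Multiset (ℕ → ℚ)}
    (hw : ∀ β ∈ S, IsIGrWeight n β ∧ β ≠ 0)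
    (hone : ¬ ({lw [1], lw [1]} : Multiset (ℕ → ℚ)) ≤ S) :
    -(k : ℚ) ≤ (S.map (excess k n)).sum := by
  have key : ∀ T : Multiset (ℕ → ℚ), T ≤ S → lw [1] ∉ T → 0 ≤ (T.map (excess k n)).sum := by
    intro T hT hmem
    refine Multiset.sum_nonneg fun x hx => ?_
    obtain ⟨β, hβ, rfl⟩ := Multiset.mem_map.1 hx
    obtain ⟨h1, h2⟩ := hw β (Multiset.mem_of_le hT hβ)
    exact excess_nonneg hk h1 h2 fun h => hmem (h ▸ hβ)
  by_cases hmem : lw [1] ∈ S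
  · obtain ⟨T, rfl⟩ := Multiset.exists_cons_of_mem hmem
    have := key T (Multiset.le_cons_self _ _) fun hT => hone <| by
      obtain ⟨U, rfl⟩ := Multiset.exists_cons_of_mem hT
      exact Multiset.cons_le_cons _ (Multiset.cons_le_cons _ (Multiset.zero_le _))
    rw [Multiset.map_cons, Multiset.sum_cons, excess_lw_one n (by omega)]
    linarith
  · have := key S le_rfl hmem
    have : (0 : ℚ) ≤ k := by positivity
    linarith

theorem excess_le {k n : ℕ} (hk : 2 ≤ k) {S : Multiset (ℕ → ℚ)}
    (hw : ∀ β ∈ S, IsIGrWeight n β ∧ β ≠ 0)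
    (hone : ¬ ({lw [1], lw [1]} : Multiset (ℕ → ℚ)) ≤ S) {β : ℕ → ℚ} (hβ : β ∈ S) :
    excess k n β ≤ (S.map (excess k n)).sum + k := by
  obtain ⟨T, rfl⟩ := Multiset.exists_cons_of_mem hβ
  have := neg_le_sum_excess hk (S := T) (fun γ hγ => hw γ (Multiset.mem_cons_of_mem hγ))
    fun h => hone (h.trans (Multiset.le_cons_self _ _))
  rw [Multiset.map_cons, Multiset.sum_cons]
  linarith

theorem headSum_le_of_excess_le {k n : ℕ} {β : ℕ → ℚ} (h : IsIGrWeight n β) {B : ℚ}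
    (hB : 0 ≤ B) (he : excess k n β ≤ B) : headSum k β ≤ B + 2 := by
  by_contra! hc
  have := h.one_le_igrRank k
  rw [excess] at he
  nlinarith

theorem exists_multiplicities {t : ℕ} (v : Fin t → ℕ → ℚ) {S : Multiset (ℕ → ℚ)}
    (h : ∀ x ∈ S, ∃ i, x = v i) :
    ∃ c : Fin t → ℕ, S = ∑ i, c i • {v i} ∧
      ∀ g : (ℕ → ℚ) → ℚ, (S.map g).sum = ∑ i, c i * g (v i) := by
  suffices ∃ c : Fin t → ℕ, S = ∑ i, c i • {v i} by
    obtain ⟨c, rfl⟩ := this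
    refine ⟨c, rfl, fun g => ?_⟩
    rw [← Multiset.coe_mapAddMonoidHom, map_sum, ← Multiset.coe_sumAddMonoidHom, map_sum]
    simp [Multiset.map_nsmul, Multiset.sum_nsmul]
  induction S using Multiset.induction_on with
  | empty => exact ⟨0, by simp⟩
  | cons a S ih =>
    obtain ⟨c, hc⟩ := ih fun x hx => h x (Multiset.mem_cons_of_mem hx)
    obtain ⟨i, rfl⟩ := h a (Multiset.mem_cons_self _ _)
    refine ⟨Pi.single i 1 + c, ?_⟩
    simp only [Pi.add_apply, add_smul, Finset.sum_add_distrib, ← hc]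
    rw [Finset.sum_eq_single i (fun j _ hj => by simp [hj]) (by simp)]
    simp

theorem multiplicity_le_one {t : ℕ} {v : Fin t → ℕ → ℚ} {c : Fin t → ℕ}
    (hone : ¬ ({lw [1], lw [1]} : Multiset (ℕ → ℚ)) ≤ ∑ i, c i • {v i}) {i : Fin t}
    (hi : v i = lw [1]) : c i ≤ 1 := by
  by_contra! hc
  refine hone (le_trans ?_ (Finset.single_le_sum (f := fun i => c i • {v i})
    (fun _ _ => Multiset.zero_le _) (Finset.mem_univ i)))
  have : ({lw [1], lw [1]} : Multiset (ℕ → ℚ)) = 2 • {lw [1]} := by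
    rw [two_nsmul]
    rfl
  rw [this, hi]
  exact nsmul_le_nsmul_left (Multiset.zero_le _) hc

theorem sum_apply_pos {n k : ℕ} {S : Multiset (ℕ → ℚ)}
    (hw : ∀ β ∈ S, IsIGrWeight n β ∧ β ≠ 0)
    (htail : ∃ β ∈ S, ∃ j, k ≤ j ∧ j < n ∧ β j ≠ 0) : 0 < (S.map fun β => β k).sum := by
  obtain ⟨β, hβ, j, hkj, -, hj⟩ := htail
  obtain ⟨T, rfl⟩ := Multiset.exists_cons_of_mem hβ
  rw [Multiset.map_cons, Multiset.sum_cons]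
  have h1 : 0 < β k := by
    obtain ⟨f, hf, -, rfl⟩ := (hw β hβ).1.exists_nat
    have h2 : f j ≠ 0 := by simpa using hj
    have := hf hkj
    exact Nat.cast_pos.2 (by omega)
  have h2 : 0 ≤ (T.map fun β => β k).sum := by
    refine Multiset.sum_nonneg fun x hx => ?_
    obtain ⟨γ, hγ, rfl⟩ := Multiset.mem_map.1 hx
    obtain ⟨f, -, -, rfl⟩ := (hw γ (Multiset.mem_cons_of_mem hγ)).1.exists_nat
    positivity
  linarith

theorem lw_append_zero (l : List ℚ) : lw (l ++ [0]) = lw l := by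
  funext i
  simp only [lw, List.getD_eq_getElem?_getD, List.getElem?_append]
  split_ifs with h
  · rfl
  · rw [List.getElem?_eq_none (not_lt.1 h)]
    rcases i - l.length with _ | j <;> simp

theorem IsIGrWeight.eq_lw_three {β : ℕ → ℚ} (h : IsIGrWeight 3 β) :
    ∃ a b c : ℕ, b ≤ a ∧ c ≤ b ∧ β = lw [(a : ℚ), b, c] := by
  obtain ⟨f, hf, h0, rfl⟩ := h.exists_nat
  refine ⟨f 0, f 1, f 2, hf (by omega), hf (by omega), funext fun i => ?_⟩
  rcases i with _ | _ | _ | i <;> simp [lw, h0]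

theorem IsIGrWeight.eq_lw_four {β : ℕ → ℚ} (h : IsIGrWeight 4 β) :
    ∃ a b c d : ℕ, b ≤ a ∧ c ≤ b ∧ d ≤ c ∧ β = lw [(a : ℚ), b, c, d] := by
  obtain ⟨f, hf, h0, rfl⟩ := h.exists_nat
  refine ⟨f 0, f 1, f 2, f 3, hf (by omega), hf (by omega), hf (by omega), funext fun i => ?_⟩
  rcases i with _ | _ | _ | _ | i <;> simp [lw, h0]

theorem IsIGrWeight.eq_lw_five {β : ℕ → ℚ} (h : IsIGrWeight 5 β) :
    ∃ a b c d e : ℕ, b ≤ a ∧ c ≤ b ∧ d ≤ c ∧ e ≤ d ∧ β = lw [(a : ℚ), b, c, d, e] := by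
  obtain ⟨f, hf, h0, rfl⟩ := h.exists_nat
  refine ⟨f 0, f 1, f 2, f 3, f 4, hf (by omega), hf (by omega), hf (by omega), hf (by omega),
    funext fun i => ?_⟩
  rcases i with _ | _ | _ | _ | _ | i <;> simp [lw, h0]

theorem igrRank_two_three (a b c : ℚ) :
    igrRank 2 3 (lw [a, b, c]) = (a - b + 1) * (c + 1) := by
  simp [igrRank, slDim, spDim, Finset.prod_range_succ, lw]
  ring

theorem igrRank_two_four (a b c d : ℚ) :
    igrRank 2 4 (lw [a, b, c, d]) =
      (a - b + 1) * ((c - d + 1) * (c + 2) * (c + d + 3) * (d + 1) / 6) := by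
  norm_num [igrRank, slDim, spDim, Finset.prod_range_succ, lw]
  ring

theorem igrRank_three_four (a b c d : ℚ) :
    igrRank 3 4 (lw [a, b, c, d]) =
      (a - b + 1) * (b - c + 1) * (a - c + 2) / 2 * (d + 1) := by
  norm_num [igrRank, slDim, spDim, Finset.prod_range_succ, lw]
  ring

theorem igrRank_four_five (a b c d e : ℚ) :
    igrRank 4 5 (lw [a, b, c, d, e]) =
      (a - b + 1) * (b - c + 1) * (c - d + 1) * (a - c + 2) * (b - d + 2) * (a - d + 3) / 12 *
        (e + 1) := by
  norm_num [igrRank, slDim, spDim, Finset.prod_range_succ, lw]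
  ring

theorem headSum_two (a b : ℚ) (l : List ℚ) : headSum 2 (lw (a :: b :: l)) = a + b := by
  simp [headSum, Finset.sum_range_succ, lw]

theorem headSum_three (a b c : ℚ) (l : List ℚ) :
    headSum 3 (lw (a :: b :: c :: l)) = a + b + c := by
  simp [headSum, Finset.sum_range_succ, lw]

theorem headSum_four (a b c d : ℚ) (l : List ℚ) :
    headSum 4 (lw (a :: b :: c :: d :: l)) = a + b + c + d := by
  simp [headSum, Finset.sum_range_succ, lw]

theorem eq_of_excess_two_four_le {β : ℕ → ℚ} (h : IsIGrWeight 4 β) (h0 : β ≠ 0)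
    (hβ : excess 2 4 β ≤ 2) :
    ∃ i, β = ![lw [1, 0, 0, 0], lw [1, 1, 0, 0], lw [2, 0, 0, 0], lw [2, 1, 0, 0],
      lw [2, 2, 0, 0], lw [1, 1, 1, 0], lw [1, 1, 1, 1]] i := by
  have hs := headSum_le_of_excess_le h (by norm_num) hβ
  have ha := h.one_le_apply_zero h0
  obtain ⟨a, b, c, d, hab, hbc, hcd, rfl⟩ := h.eq_lw_four
  rw [excess, igrRank_two_four, headSum_two] at hβ
  rw [headSum_two] at hs
  have ha : 1 ≤ a := Nat.one_le_cast.1 (show (1 : ℚ) ≤ (a : ℚ) from ha)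
  have hs : a + b ≤ 4 := by
    norm_num at hs
    exact_mod_cast hs
  have ha' : a ≤ 4 := by omega
  simp only [Fin.exists_fin_succ, Matrix.cons_val_zero, Matrix.cons_val_succ, IsEmpty.exists_iff,
    or_false]
  clear h h0
  interval_cases a
  all_goals interval_cases b <;> try omega
  all_goals interval_cases c
  all_goals interval_cases d
  all_goals revert hβ; norm_num

theorem eq_of_excess_three_four_le {β : ℕ → ℚ} (h : IsIGrWeight 4 β) (h0 : β ≠ 0)
    (hβ : excess 3 4 β ≤ 5) :
    ∃ i, β = ![lw [1, 0, 0, 0], lw [1, 1, 0, 0], lw [2, 0, 0, 0], lw [1, 1, 1, 0],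
      lw [2, 2, 2, 0], lw [1, 1, 1, 1]] i := by
  have hs := headSum_le_of_excess_le h (by norm_num) hβ
  have ha := h.one_le_apply_zero h0
  obtain ⟨a, b, c, d, hab, hbc, hcd, rfl⟩ := h.eq_lw_four
  rw [excess, igrRank_three_four, headSum_three] at hβ
  rw [headSum_three] at hs
  have ha : 1 ≤ a := Nat.one_le_cast.1 (show (1 : ℚ) ≤ (a : ℚ) from ha)
  have hs : a + b + c ≤ 7 := by
    norm_num at hs
    exact_mod_cast hs
  have ha' : a ≤ 7 := by omega
  simp only [Fin.exists_fin_succ, Matrix.cons_val_zero, Matrix.cons_val_succ, IsEmpty.exists_iff,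
    or_false]
  clear h h0
  interval_cases a
  all_goals interval_cases b <;> try omega
  all_goals interval_cases c <;> try omega
  all_goals interval_cases d
  all_goals revert hβ; norm_num

theorem eq_of_excess_four_five_le {β : ℕ → ℚ} (h : IsIGrWeight 5 β) (h0 : β ≠ 0)
    (hβ : excess 4 5 β ≤ 4) :
    ∃ i, β = ![lw [1, 0, 0, 0, 0], lw [1, 1, 0, 0, 0], lw [2, 0, 0, 0, 0],
      lw [1, 1, 1, 0, 0], lw [1, 1, 1, 1, 0], lw [1, 1, 1, 1, 1]] i := by
  have hs := headSum_le_of_excess_le h (by norm_num) hβ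
  have ha := h.one_le_apply_zero h0
  obtain ⟨a, b, c, d, e, hab, hbc, hcd, hde, rfl⟩ := h.eq_lw_five
  rw [excess, igrRank_four_five, headSum_four] at hβ
  rw [headSum_four] at hs
  have ha : 1 ≤ a := Nat.one_le_cast.1 (show (1 : ℚ) ≤ (a : ℚ) from ha)
  have hs : a + b + c + d ≤ 6 := by
    norm_num at hs
    exact_mod_cast hs
  have ha' : a ≤ 6 := by omega
  simp only [Fin.exists_fin_succ, Matrix.cons_val_zero, Matrix.cons_val_succ, IsEmpty.exists_iff,
    or_false]
  clear h h0
  interval_cases a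
  all_goals interval_cases b <;> try omega
  all_goals interval_cases c <;> try omega
  all_goals interval_cases d <;> try omega
  all_goals interval_cases e
  all_goals revert hβ; norm_num

theorem eq_zero_of_sum_igrRank_le_zero {k n : ℕ} {S : Multiset (ℕ → ℚ)}
    (hw : ∀ β ∈ S, IsIGrWeight n β) (h : (S.map (igrRank k n)).sum ≤ 0) : S = 0 := by
  have h1 := Multiset.card_nsmul_le_sum (s := S.map (igrRank k n)) (a := 1) fun x hx => by
    obtain ⟨β, hβ, rfl⟩ := Multiset.mem_map.1 hx
    exact (hw β hβ).one_le_igrRank k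
  have h2 : (S.card : ℚ) ≤ 0 := by simpa using h1.trans h
  exact Multiset.card_eq_zero.1 (by exact_mod_cast h2.antisymm (by positivity))

theorem igrFourfolds_two_three {S : Multiset (ℕ → ℚ)}
    (hw : ∀ β ∈ S, IsIGrWeight 3 β ∧ β ≠ 0)
    (htail : ∃ β ∈ S, ∃ j, 2 ≤ j ∧ j < 3 ∧ β j ≠ 0)
    (hr : (S.map (igrRank 2 3)).sum = 3) (hd : (S.map (igrDex 2 3)).sum = 5) :
    S = {lw [1, 1, 1], lw [3, 3]} ∨ S = {lw [2, 2, 1], lw [1, 1]} := by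
  obtain ⟨β, hβ, j, hj2, hj3, hj⟩ := htail
  obtain rfl : j = 2 := by omega
  obtain ⟨T, rfl⟩ := Multiset.exists_cons_of_mem hβ
  have hT : ∀ γ ∈ T, IsIGrWeight 3 γ := fun γ hγ => (hw γ (Multiset.mem_cons_of_mem hγ)).1
  obtain ⟨a, b, c, hab, hbc, rfl⟩ := (hw β hβ).1.eq_lw_three
  have hc : 1 ≤ c := Nat.one_le_iff_ne_zero.2 fun h => hj (by simp [lw, h])
  simp only [Multiset.map_cons, Multiset.sum_cons, igrDex, headSum_two, igrRank_two_three]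
    at hr hd
  obtain ⟨p, rfl⟩ := Nat.exists_eq_add_of_le hab
  obtain rfl | ⟨γ, hγ⟩ := T.empty_or_exists_mem
  · simp only [Multiset.map_zero, Multiset.sum_zero, add_zero] at hr hd
    push_cast at hr hd
    rw [show (b : ℚ) + p - b + 1 = p + 1 by ring] at hr hd
    rw [hr] at hd
    have hr' : (p + 1) * (c + 1) = 3 := by exact_mod_cast hr
    have hd' : 3 * (b + p + b) = 10 := by
      have : (3 : ℚ) * (b + p + b) = 10 := by linarith
      exact_mod_cast this
    omega
  · obtain ⟨U, rfl⟩ := Multiset.exists_cons_of_mem hγ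
    obtain ⟨x, y, z, hxy, hyz, rfl⟩ := (hT γ hγ).eq_lw_three
    obtain ⟨q, rfl⟩ := Nat.exists_eq_add_of_le hxy
    have h1 := (hT _ hγ).one_le_igrRank 2
    simp only [Multiset.map_cons, Multiset.sum_cons, igrDex, headSum_two, igrRank_two_three]
      at hr hd h1
    push_cast at hr hd h1
    have hc' : (1 : ℚ) ≤ c := by exact_mod_cast hc
    have hp' : (0 : ℚ) ≤ p := by positivity
    have hU : U = 0 := eq_zero_of_sum_igrRank_le_zero (k := 2)
      (fun δ hδ => hT δ (Multiset.mem_cons_of_mem hδ)) (by nlinarith)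
    subst hU
    simp only [Multiset.map_zero, Multiset.sum_zero, add_zero] at hr hd
    have hr' : (p + 1) * (c + 1) + (q + 1) * (z + 1) = 3 := by
      have : ((p : ℚ) + 1) * (c + 1) + (q + 1) * (z + 1) = 3 := by linarith
      exact_mod_cast this
    obtain rfl : p = 0 := by nlinarith
    obtain rfl : c = 1 := by nlinarith
    obtain rfl : q = 0 := by nlinarith
    obtain rfl : z = 0 := by nlinarith
    have hd' : 2 * b + y = 5 := by
      have : (2 : ℚ) * b + y = 5 := by linarith
      exact_mod_cast this
    have hb : b ≤ 2 := by omega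
    have hpad : ∀ t : ℚ, lw [t, t, 0] = lw [t, t] := fun t => lw_append_zero [t, t]
    interval_cases b
    · obtain rfl : y = 3 := by omega
      left
      norm_num [← hpad]
    · obtain rfl : y = 1 := by omega
      right
      norm_num [← hpad]

theorem lw_pad_two (x y : ℚ) : lw [x, y, 0, 0] = lw [x, y] :=
  (lw_append_zero [x, y, 0]).trans (lw_append_zero [x, y])

theorem lw_pad_one (x : ℚ) : lw [x, 0, 0, 0] = lw [x] :=
  (lw_pad_two x 0).trans (lw_append_zero [x])

theorem lw_pad_three (x y z : ℚ) : lw [x, y, z, 0] = lw [x, y, z] :=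
  lw_append_zero [x, y, z]

theorem igrFourfolds_two_four {S : Multiset (ℕ → ℚ)}
    (hw : ∀ β ∈ S, IsIGrWeight 4 β ∧ β ≠ 0)
    (hone : ¬ ({lw [1], lw [1]} : Multiset (ℕ → ℚ)) ≤ S)
    (htail : 0 < (S.map fun β => β 2).sum)
    (hr : (S.map (igrRank 2 4)).sum = 7) (he : (S.map (excess 2 4)).sum = 0) :
    S = {lw [1, 1, 1, 1], lw [1, 1], lw [1, 1]} ∨
    S = {lw [1, 1, 1], lw [1, 1], lw [1, 1], lw [1, 1]} ∨
    S = {lw [1, 1, 1], lw [1], lw [2, 2]} ∨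
    S = {lw [1, 1, 1], lw [2]} := by
  obtain ⟨c, rfl, hc⟩ := exists_multiplicities _ fun β hβ =>
    eq_of_excess_two_four_le (hw β hβ).1 (hw β hβ).2 <|
      (excess_le le_rfl hw hone hβ).trans (by norm_num [he])
  have hc0 := multiplicity_le_one hone (i := 0) (lw_pad_one 1)
  rw [hc] at hr he htail
  clear hc hw hone
  simp only [Fin.sum_univ_seven, Matrix.cons_val, igrRank_two_four, excess, headSum_two]
    at hr he htail ⊢
  simp only [lw] at htail
  generalize c 0 = n₀ at *
  generalize c 1 = n₁ at *
  generalize c 2 = n₂ at *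
  generalize c 3 = n₃ at *
  generalize c 4 = n₄ at *
  generalize c 5 = n₅ at *
  generalize c 6 = n₆ at *
  have hr' : 2 * n₀ + n₁ + 3 * n₂ + 2 * n₃ + n₄ + 4 * n₅ + 5 * n₆ = 7 := by
    qify
    linarith
  have he' : 2 * n₃ + 2 * n₄ = 2 * n₀ := by
    qify
    linarith
  have ht' : 0 < n₅ + n₆ := by
    norm_num at htail
    exact_mod_cast htail
  simp only [lw_pad_one, Multiset.insert_eq_cons, ← Multiset.singleton_add]
  simp only [lw_pad_two, lw_pad_three 1 1 1]
  clear hr he htail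
  obtain ⟨rfl, rfl, rfl, rfl, rfl, rfl, rfl⟩ | ⟨rfl, rfl, rfl, rfl, rfl, rfl, rfl⟩ |
      ⟨rfl, rfl, rfl, rfl, rfl, rfl, rfl⟩ | ⟨rfl, rfl, rfl, rfl, rfl, rfl, rfl⟩ :
      (n₀ = 0 ∧ n₁ = 2 ∧ n₂ = 0 ∧ n₃ = 0 ∧ n₄ = 0 ∧ n₅ = 0 ∧ n₆ = 1) ∨
      (n₀ = 0 ∧ n₁ = 3 ∧ n₂ = 0 ∧ n₃ = 0 ∧ n₄ = 0 ∧ n₅ = 1 ∧ n₆ = 0) ∨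
      (n₀ = 1 ∧ n₁ = 0 ∧ n₂ = 0 ∧ n₃ = 0 ∧ n₄ = 1 ∧ n₅ = 1 ∧ n₆ = 0) ∨
      (n₀ = 0 ∧ n₁ = 0 ∧ n₂ = 1 ∧ n₃ = 0 ∧ n₄ = 0 ∧ n₅ = 1 ∧ n₆ = 0) := by
    have h₅ : n₅ ≤ 1 := by omega
    have h₆ : n₆ ≤ 1 := by omega
    interval_cases n₀ <;> interval_cases n₅ <;> interval_cases n₆ <;> omega
  · left
    simp only [zero_nsmul, zero_add, add_zero]
    abel
  · right; left
    simp only [zero_nsmul, zero_add, add_zero]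
    abel
  · right; right; left
    simp only [zero_nsmul, add_zero]
    abel
  · right; right; right
    simp only [zero_nsmul, zero_add, add_zero]
    abel

theorem igrFourfolds_three_four {S : Multiset (ℕ → ℚ)}
    (hw : ∀ β ∈ S, IsIGrWeight 4 β ∧ β ≠ 0)
    (hone : ¬ ({lw [1], lw [1]} : Multiset (ℕ → ℚ)) ≤ S)
    (htail : 0 < (S.map fun β => β 3).sum)
    (hr : (S.map (igrRank 3 4)).sum = 8) (he : (S.map (excess 3 4)).sum = 2) :
    S = {lw [1, 1, 1, 1], lw [1, 1], lw [1, 1]} ∨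
    S = {lw [1, 1, 1, 1], lw [2]} ∨
    S = {lw [1, 1, 1, 1], lw [1], lw [1, 1, 1], lw [1, 1, 1], lw [1, 1, 1]} ∨
    S = {lw [1, 1, 1, 1], lw [1, 1, 1, 1], lw [1], lw [1, 1, 1]} := by
  obtain ⟨c, rfl, hc⟩ := exists_multiplicities _ fun β hβ =>
    eq_of_excess_three_four_le (hw β hβ).1 (hw β hβ).2 <|
      (excess_le (by norm_num) hw hone hβ).trans (by norm_num [he])
  have hc0 := multiplicity_le_one hone (i := 0) (lw_pad_one 1)
  rw [hc] at hr he htail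
  clear hc hw hone
  simp only [Fin.sum_univ_six, Matrix.cons_val, igrRank_three_four, excess, headSum_three]
    at hr he htail ⊢
  simp only [lw] at htail
  generalize c 0 = n₀ at *
  generalize c 1 = n₁ at *
  generalize c 2 = n₂ at *
  generalize c 3 = n₃ at *
  generalize c 4 = n₄ at *
  generalize c 5 = n₅ at *
  have hr' : 3 * n₀ + 3 * n₁ + 6 * n₂ + n₃ + n₄ + 2 * n₅ = 8 := by
    qify
    linarith
  have he' : n₃ + 4 * n₄ + 2 * n₅ = 2 + 3 * n₀ := by
    qify
    linarith
  have ht' : 0 < n₅ := by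
    norm_num at htail
    exact_mod_cast htail
  simp only [lw_pad_one, Multiset.insert_eq_cons, ← Multiset.singleton_add]
  simp only [lw_pad_two, lw_pad_three 1 1 1]
  clear hr he htail
  obtain ⟨rfl, rfl, rfl, rfl, rfl, rfl⟩ | ⟨rfl, rfl, rfl, rfl, rfl, rfl⟩ |
      ⟨rfl, rfl, rfl, rfl, rfl, rfl⟩ | ⟨rfl, rfl, rfl, rfl, rfl, rfl⟩ :
      (n₀ = 0 ∧ n₁ = 2 ∧ n₂ = 0 ∧ n₃ = 0 ∧ n₄ = 0 ∧ n₅ = 1) ∨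
      (n₀ = 0 ∧ n₁ = 0 ∧ n₂ = 1 ∧ n₃ = 0 ∧ n₄ = 0 ∧ n₅ = 1) ∨
      (n₀ = 1 ∧ n₁ = 0 ∧ n₂ = 0 ∧ n₃ = 3 ∧ n₄ = 0 ∧ n₅ = 1) ∨
      (n₀ = 1 ∧ n₁ = 0 ∧ n₂ = 0 ∧ n₃ = 1 ∧ n₄ = 0 ∧ n₅ = 2) := by
    have h₅ : n₅ ≤ 4 := by omega
    interval_cases n₀ <;> interval_cases n₅ <;> omega
  · left
    simp only [zero_nsmul, zero_add, add_zero]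
    abel
  · right; left
    simp only [zero_nsmul, zero_add, add_zero]
    abel
  · right; right; left
    simp only [zero_nsmul, add_zero]
    abel
  · right; right; right
    simp only [zero_nsmul, add_zero]
    abel

theorem not_igrFourfolds_four_five {S : Multiset (ℕ → ℚ)}
    (hw : ∀ β ∈ S, IsIGrWeight 5 β ∧ β ≠ 0)
    (hone : ¬ ({lw [1], lw [1]} : Multiset (ℕ → ℚ)) ≤ S)
    (htail : 0 < (S.map fun β => β 4).sum)
    (hr : (S.map (igrRank 4 5)).sum = 14) (he : (S.map (excess 4 5)).sum = 0) : False := by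
  obtain ⟨c, rfl, hc⟩ := exists_multiplicities _ fun β hβ =>
    eq_of_excess_four_five_le (hw β hβ).1 (hw β hβ).2 <|
      (excess_le (by norm_num) hw hone hβ).trans (by norm_num [he])
  have hc0 := multiplicity_le_one hone (i := 0)
    ((lw_append_zero [1, 0, 0, 0]).trans (lw_pad_one 1))
  rw [hc] at hr he htail
  clear hc hw hone
  simp only [Fin.sum_univ_six, Matrix.cons_val, igrRank_four_five, excess, headSum_four]
    at hr he htail
  simp only [lw] at htail
  have hr' : 4 * c 0 + 6 * c 1 + 10 * c 2 + 4 * c 3 + c 4 + 2 * c 5 = 14 := by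
    qify
    linarith
  have he' : 4 * c 3 + 2 * c 4 + 4 * c 5 = 4 * c 0 := by
    qify
    linarith
  have ht' : 0 < c 5 := by
    norm_num at htail
    exact_mod_cast htail
  obtain h | h : c 0 = 0 ∨ c 0 = 1 := by omega
  all_goals omega

theorem two_le_igrRank_of_apply_ne_zero {k : ℕ} {β : ℕ → ℚ} (h : IsIGrWeight (k + 1) β)
    (hβ : β k ≠ 0) : 2 ≤ igrRank k (k + 1) β := by
  obtain ⟨f, hf, -, rfl⟩ := h.exists_nat
  have h1 : (1 : ℚ) ≤ f k := by
    exact_mod_cast Nat.one_le_iff_ne_zero.2 fun h => hβ (by simp [h])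
  have h2 := one_le_slDim k (β := fun i => (f i : ℚ)) fun i j hij => Nat.cast_le.2 (hf hij)
  have h3 : spDim 1 (fun i => (f (k + i) : ℚ)) = 1 + f k := by
    simp [spDim, slDim]
    ring
  rw [igrRank, Nat.add_sub_cancel_left, h3]
  nlinarith

/-- Classification of fourfolds with trivial canonical bundle in symplectic
Grassmannians `IGr(k,2n)`. -/
theorem stmt12 (n k : ℕ) (hn : 3 ≤ n) (hk : 2 ≤ k) (hkn : k ≤ n - 1)
    (S : Multiset (ℕ → ℚ))
    (hw : ∀ β ∈ S, IsIGrWeight n β ∧ β ≠ 0)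
    (htail : ∃ β ∈ S, ∃ j, k ≤ j ∧ j < n ∧ β j ≠ 0)
    (hone : ¬ ({lw [1], lw [1]} : Multiset (ℕ → ℚ)) ≤ S)
    (hr : (S.map (igrRank k n)).sum =
      (k : ℚ) * (2 * (n : ℚ) - (k : ℚ)) - (k : ℚ) * ((k : ℚ) - 1) / 2 - 4)
    (hd : (S.map (igrDex k n)).sum = 2 * (n : ℚ) - (k : ℚ) + 1) :
    (k = 2 ∧ n = 3 ∧ S = {lw [1, 1, 1], lw [3, 3]}) ∨
    (k = 2 ∧ n = 3 ∧ S = {lw [2, 2, 1], lw [1, 1]}) ∨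
    (k = 2 ∧ n = 4 ∧ S = {lw [1, 1, 1, 1], lw [1, 1], lw [1, 1]}) ∨
    (k = 2 ∧ n = 4 ∧ S = {lw [1, 1, 1], lw [1, 1], lw [1, 1], lw [1, 1]}) ∨
    (k = 2 ∧ n = 4 ∧ S = {lw [1, 1, 1], lw [1], lw [2, 2]}) ∨
    (k = 2 ∧ n = 4 ∧ S = {lw [1, 1, 1], lw [2]}) ∨
    (k = 3 ∧ n = 4 ∧ S = {lw [1, 1, 1, 1], lw [1, 1], lw [1, 1]}) ∨
    (k = 3 ∧ n = 4 ∧ S = {lw [1, 1, 1, 1], lw [2]}) ∨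
    (k = 3 ∧ n = 4 ∧
      S = {lw [1, 1, 1, 1], lw [1], lw [1, 1, 1], lw [1, 1, 1], lw [1, 1, 1]}) ∨
    (k = 3 ∧ n = 4 ∧ S = {lw [1, 1, 1, 1], lw [1, 1, 1, 1], lw [1], lw [1, 1, 1]}) := by
  have hw' : ∀ β ∈ S, IsIGrWeight n β := fun β hβ => (hw β hβ).1
  have hpos := sum_apply_pos hw htail
  have hsum := sum_excess (n := n) hk S
  rw [hr, hd] at hsum
  obtain ⟨m, rfl⟩ : ∃ m, n = k + m := ⟨n - k, by omega⟩
  have hm : 1 ≤ m := by omega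
  replace hsum : (S.map (excess k (k + m))).sum = 8 - 2 * k * m := by
    rw [hsum]
    push_cast
    ring
  have hbound : ∀ β ∈ S, ∀ j, k ≤ j → β j ≠ 0 → ∀ r : ℚ, 1 ≤ r → r ≤ igrRank k (k + m) β →
      ((k : ℚ) - 2) * r ≤ 8 - 2 * k * m + k := by
    intro β hβ j hj hne r hr1 hrle
    have h1 := excess_le hk hw hone hβ
    have h2 := (hw' β hβ).le_headSum hj hne
    have h3 : (2 : ℚ) ≤ k := by exact_mod_cast hk
    rw [hsum, excess] at h1
    refine le_trans ?_ h1
    exact mul_le_mul (by linarith) hrle (by linarith) (by linarith)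
  obtain ⟨β, hβ, j, hkj, hjn, hne⟩ := id htail
  have hkm : k * m ≤ 5 := by
    have := hbound β hβ j hkj hne 1 le_rfl ((hw' β hβ).one_le_igrRank k)
    have : (k : ℚ) * m ≤ 5 := by linarith
    exact_mod_cast this
  have hk5 : k ≤ 5 := by nlinarith
  have hm2 : m ≤ 2 := by nlinarith
  interval_cases m
  · obtain rfl : j = k := by omega
    have hj4 : j ≤ 4 := by
      have := hbound β hβ j le_rfl hne 2 one_le_two
        (two_le_igrRank_of_apply_ne_zero (hw' β hβ) hne)
      have : (3 : ℚ) * j ≤ 12 := by push_cast at this; linarith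
      have : 3 * j ≤ 12 := by exact_mod_cast this
      omega
    interval_cases j
    · have := igrFourfolds_two_three hw htail (by rw [hr]; norm_num) (by rw [hd]; norm_num)
      simpa using this
    · have := igrFourfolds_three_four hw hone hpos (by rw [hr]; norm_num) (by rw [hsum]; norm_num)
      simpa using this
    · exact (not_igrFourfolds_four_five hw hone hpos (by rw [hr]; norm_num)
        (by rw [hsum]; norm_num)).elim
  · obtain rfl : k = 2 := by omega
    have := igrFourfolds_two_four hw hone hpos (by rw [hr]; norm_num) (by rw [hsum]; norm_num)
    simpa using this
end

section
/- (Classification of fourfolds with trivial canonical bundle in the odd orthogonal Grassmannians OGr(n−1,2n+1).) Let n ≥ 2, set k = n−1, and let β¹, …, β^m be nonzero weights for OGr(n−1,2n+1) such that: no β^i equals (1,0,…,0); at least one β^i has non-integer entries or has β^i_n ≠ 0; ∑_i rank(β^i) = (n−1)(n+2) − n(n−1)/2 − 4; and ∑_i dex(β^i) = n + 1. Then, up to reordering, (n, (β¹,…,β^m)) is one of the following six: (1) n=3: (1/2,1/2,1/2), (3,3,0); (2) n=3: (3/2,3/2,1/2), (1,1,0); (3) n=4: (1/2,1/2,1/2,1/2)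 three times, (1,1,1,0) twice; (4) n=4: (1/2,1/2,1/2,1/2) twice, (1,1,0,0), (1,1,1,0); (5) n=4: (1/2,1/2,1/2,1/2), (1,1,0,0), (1,1,0,0); (6) n=4: (1/2,1/2,1/2,1/2), (2,0,0,0). -/
open Finset

theorem soOddDim_one (β : ℕ → ℚ) : soOddDim 1 β = 2 * β 0 + 1 := by
  simp [soOddDim, slDim]
  ring

theorem slDim_pos (r : ℕ) (β : ℕ → ℚ) (h : ∀ i j, i ≤ j → j < r → β j ≤ β i) :
    0 < slDim r β := by
  refine Finset.prod_pos fun i _ => Finset.prod_pos fun j hj => ?_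
  split_ifs with hij
  · have h1 := h i j hij.le (Finset.mem_range.1 hj)
    have h2 : (i : ℚ) < j := by exact_mod_cast hij
    exact div_pos (by linarith) (by linarith)
  · exact one_pos

theorem slDim_two (β : ℕ → ℚ) : slDim 2 β = β 0 - β 1 + 1 := by
  simp [slDim, Finset.prod_range_succ]
  ring

theorem slDim_three (β : ℕ → ℚ) :
    slDim 3 β = (β 0 - β 1 + 1) * (β 1 - β 2 + 1) * (β 0 - β 2 + 2) / 2 := by
  simp [slDim, Finset.prod_range_succ]
  ring

theorem ogrOddRank_sub_one (m : ℕ) (β : ℕ → ℚ) :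
    ogrOddRank m (m + 1) β = slDim m β * (2 * β m + 1) := by
  simp [ogrOddRank, soOddDim_one]

theorem ogrOddRank_pos {m : ℕ} {β : ℕ → ℚ} (h : IsOGrOddWeight (m + 1) β) :
    0 < ogrOddRank m (m + 1) β := by
  obtain ⟨-, hanti, hnn, -⟩ := h
  rw [ogrOddRank_sub_one]
  have := hnn m (by omega)
  exact mul_pos (slDim_pos m β fun i j hij hj => hanti i j hij (by omega)) (by linarith)

/-- A nonzero weight other than `(1,0,…,0)` has head sum at least `2`, or at least `k/2`. -/
theorem le_headSum {m : ℕ} (hm : 2 ≤ m) {β : ℕ → ℚ} (h : IsOGrOddWeight (m + 1) β)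
    (h0 : β ≠ 0) (h1 : β ≠ lw [1]) : 2 ≤ headSum m β ∨ (m : ℚ) / 2 ≤ headSum m β := by
  obtain ⟨hint | hhalf, hanti, hnn, hz⟩ := h
  · left
    obtain ⟨x, hx⟩ := hint 0 (by omega)
    obtain ⟨y, hy⟩ := hint 1 (by omega)
    have hle : β 0 + β 1 ≤ headSum m β := by
      have := Finset.sum_le_sum_of_subset_of_nonneg (f := β)
        (Finset.range_mono hm) (fun i hi _ => hnn i (by simp at hi; omega))
      simpa [Finset.sum_range_succ, headSum] using this
    refine le_trans ?_ hle
    have hxy := hanti 0 1 (by omega) (by omega)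
    have hy0 := hnn 1 (by omega)
    have hx1 : 1 ≤ x := by
      by_contra hlt
      refine h0 (funext fun i => ?_)
      have hx0 : (x : ℚ) ≤ 0 := by exact_mod_cast (by omega : x ≤ 0)
      by_cases hi : i < m + 1
      · exact le_antisymm (by have := hanti 0 i (by omega) hi; simp; linarith) (hnn i hi)
      · exact hz i (by omega)
    rw [hx, hy] at hxy ⊢
    rw [hy] at hy0
    norm_cast at hxy hy0 ⊢
    by_contra hlt
    obtain ⟨rfl, rfl⟩ : x = 1 ∧ y = 0 := by omega
    refine h1 (funext fun i => ?_)
    rcases i with _ | i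
    · simp [hx, lw]
    · simp only [lw, List.getD_cons_succ, List.getD_nil]
      by_cases hi : i + 1 < m + 1
      · exact le_antisymm (by have := hanti 1 (i + 1) (by omega) hi; simpa [hy] using this)
          (hnn _ hi)
      · exact hz _ (by omega)
  · right
    have : ∑ _i ∈ Finset.range m, (1 / 2 : ℚ) ≤ headSum m β := by
      refine Finset.sum_le_sum fun i hi => ?_
      have hi' : i < m + 1 := by simp at hi; omega
      obtain ⟨z, hzi⟩ := hhalf i hi'
      have hn := hnn i hi'
      have hz0 : 0 ≤ z := by
        by_contra hlt
        have : (z : ℚ) ≤ -1 := by exact_mod_cast (by omega : z ≤ -1)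
        linarith
      have : (0 : ℚ) ≤ z := by exact_mod_cast hz0
      linarith
    simp at this
    linarith

theorem mul_sum_rank_le_sum_dex {m n : ℕ} (c : ℚ) (S : Multiset (ℕ → ℚ))
    (hS : ∀ β ∈ S, 0 < ogrOddRank m n β ∧ c ≤ headSum m β / m) :
    c * (S.map (ogrOddRank m n)).sum ≤ (S.map (ogrOddDex m n)).sum := by
  rw [← Multiset.sum_map_mul_left]
  exact Multiset.sum_map_le_sum_map _ _ fun β hβ =>
    mul_le_mul_of_nonneg_right (hS β hβ).2 (hS β hβ).1.le

theorem ogrOddRank_three (β : ℕ → ℚ) :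
    ogrOddRank 2 3 β = (β 0 - β 1 + 1) * (2 * β 2 + 1) := by
  rw [ogrOddRank_sub_one, slDim_two]

theorem ogrOddRank_four (β : ℕ → ℚ) :
    ogrOddRank 3 4 β =
      (β 0 - β 1 + 1) * (β 1 - β 2 + 1) * (β 0 - β 2 + 2) / 2 * (2 * β 3 + 1) := by
  rw [ogrOddRank_sub_one, slDim_three]

theorem headSum_two_s14 (β : ℕ → ℚ) : headSum 2 β = β 0 + β 1 := by
  simp [headSum, Finset.sum_range_succ]

theorem headSum_three_s14 (β : ℕ → ℚ) : headSum 3 β = β 0 + β 1 + β 2 := by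
  simp [headSum, Finset.sum_range_succ]

/-- Entries of a weight are `z + p/2` with integers `z` and a common `p ∈ {0,1}`. -/
theorem IsOGrOddWeight.exists_int {n : ℕ} {β : ℕ → ℚ} (h : IsOGrOddWeight n β) :
    ∃ (p : ℤ) (x : ℕ → ℤ), (p = 0 ∨ p = 1) ∧ (∀ i, i < n → β i = x i + (p : ℚ) / 2) ∧
      (∀ i j, i ≤ j → j < n → x j ≤ x i) ∧ (∀ i, i < n → 0 ≤ x i) := by
  obtain ⟨hp, hanti, hnn, -⟩ := h
  have key : ∃ p : ℤ, (p = 0 ∨ p = 1) ∧ ∀ i, ∃ z : ℤ, i < n → β i = z + (p : ℚ) / 2 := by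
    rcases hp with hp | hp
    · refine ⟨0, Or.inl rfl, fun i => ?_⟩
      by_cases hi : i < n
      · obtain ⟨z, hz⟩ := hp i hi
        exact ⟨z, fun _ => by simp [hz]⟩
      · exact ⟨0, fun h => absurd h hi⟩
    · refine ⟨1, Or.inr rfl, fun i => ?_⟩
      by_cases hi : i < n
      · obtain ⟨z, hz⟩ := hp i hi
        exact ⟨z, fun _ => by simp [hz]⟩
      · exact ⟨0, fun h => absurd h hi⟩
  obtain ⟨p, hp01, hz⟩ := key
  choose x hx using hz
  refine ⟨p, x, hp01, hx, fun i j hij hj => ?_, fun i hi => ?_⟩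
  · have := hanti i j hij hj
    rw [hx i (by omega), hx j hj] at this
    exact_mod_cast (by linarith : (x j : ℚ) ≤ x i)
  · have := hnn i hi
    rw [hx i hi] at this
    by_contra hlt
    have h1 : (x i : ℚ) ≤ -1 := by exact_mod_cast (by omega : x i ≤ -1)
    have h2 : (p : ℚ) ≤ 1 := by exact_mod_cast (by omega : p ≤ 1)
    linarith

theorem eq_lw_of_three {β : ℕ → ℚ} (h : IsOGrOddWeight 3 β) {a b c : ℚ}
    (ha : β 0 = a) (hb : β 1 = b) (hc : β 2 = c) : β = lw [a, b, c] := by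
  funext i
  rcases i with _ | _ | _ | i
  · simpa [lw] using ha
  · simpa [lw] using hb
  · simpa [lw] using hc
  · simpa [lw] using h.2.2.2 (i + 3) (by omega)

theorem eq_lw_of_four {β : ℕ → ℚ} (h : IsOGrOddWeight 4 β) {a b c d : ℚ}
    (ha : β 0 = a) (hb : β 1 = b) (hc : β 2 = c) (hd : β 3 = d) : β = lw [a, b, c, d] := by
  funext i
  rcases i with _ | _ | _ | _ | i
  · simpa [lw] using ha
  · simpa [lw] using hb
  · simpa [lw] using hc
  · simpa [lw] using hd
  · simpa [lw] using h.2.2.2 (i + 4) (by omega)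

/-- The weights on `OGr(3,9)` whose dex does not exceed `1 + rank/2`. -/
theorem weight_four_classification {β : ℕ → ℚ} (h : IsOGrOddWeight 4 β)
    (h0 : β ≠ 0) (h1 : β ≠ lw [1])
    (hle : ogrOddDex 3 4 β ≤ 1 + ogrOddRank 3 4 β / 2) :
    β = lw [1/2, 1/2, 1/2, 1/2] ∨ β = lw [1, 1] ∨ β = lw [2] ∨ β = lw [1, 1, 1] := by
  have hs := le_headSum (m := 3) (by norm_num) h h0 h1
  have hpos := ogrOddRank_pos (m := 3) h
  obtain ⟨p, x, hp, hx, hanti, hnn⟩ := h.exists_int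
  have e0 := hx 0 (by norm_num)
  have e1 := hx 1 (by norm_num)
  have e2 := hx 2 (by norm_num)
  have e3 := hx 3 (by norm_num)
  have a1 := hanti 0 1 (by norm_num) (by norm_num)
  have a2 := hanti 1 2 (by norm_num) (by norm_num)
  have a3 := hanti 2 3 (by norm_num) (by norm_num)
  have a4 := hnn 3 (by norm_num)
  rw [headSum_three_s14, e0, e1, e2] at hs
  rw [ogrOddDex, headSum_three_s14, ogrOddRank_four, e0, e1, e2, e3] at hle
  generalize x 0 = x0 at *
  generalize x 1 = x1 at *
  generalize x 2 = x2 at *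
  generalize x 3 = x3 at *
  by_cases hbig : 6 ≤ 2 * (x0 + x1 + x2) + 3 * p
  · obtain ⟨a, rfl⟩ : ∃ a : ℤ, x1 = x2 + a := ⟨x1 - x2, by ring⟩
    obtain ⟨b, rfl⟩ : ∃ b : ℤ, x0 = x2 + a + b := ⟨x0 - (x2 + a), by ring⟩
    have ha : 0 ≤ a := by omega
    have hb : 0 ≤ b := by omega
    have hp0 : 0 ≤ p := by omega
    have hq : (6 : ℚ) ≤ 2 * (((x2 + a + b : ℤ) : ℚ) + (x2 + a : ℤ) + x2) + 3 * p := by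
      exact_mod_cast hbig
    have hr : (b + 1) * (a + 1) * (a + b + 2) * (2 * x3 + p + 1) ≤ 4 := by
      rw [ogrOddRank_four, e0, e1, e2, e3] at hpos
      have : ((b + 1) * (a + 1) * (a + b + 2) * (2 * x3 + p + 1) : ℚ) ≤ 4 := by
        push_cast at *
        nlinarith
      exact_mod_cast this
    have hab : a = 0 ∧ b = 0 := by
      have hA : 1 * (a + b + 1) ≤ (b + 1) * (a + 1) := by nlinarith [mul_nonneg ha hb]
      have hB : (a + b + 1) * (a + b + 2) ≤ (b + 1) * (a + 1) * (a + b + 2) := by nlinarith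
      have hC : (b + 1) * (a + 1) * (a + b + 2) ≤
          (b + 1) * (a + 1) * (a + b + 2) * (2 * x3 + p + 1) := by
        have : 0 ≤ (b + 1) * (a + 1) * (a + b + 2) := by positivity
        nlinarith
      have : a + b < 1 := by nlinarith
      omega
    obtain ⟨rfl, rfl⟩ := hab
    have hx3 : x3 = 0 := by omega
    subst hx3
    rcases hp with rfl | rfl
    · norm_num at hle
      have : x2 ≤ 1 := by
        have : (x2 : ℚ) < 2 := by linarith
        have : x2 < 2 := by exact_mod_cast this
        omega
      obtain rfl : x2 = 1 := by omega
      right; right; right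
      rw [← lw_append_zero [1, 1, 1]]
      apply eq_lw_of_four h <;> simp [e0, e1, e2, e3]
    · norm_num at hle
      have : x2 ≤ 0 := by
        have : (x2 : ℚ) < 1 := by linarith
        have : x2 < 1 := by exact_mod_cast this
        omega
      omega
  · rcases hp with rfl | rfl
    · have hs2 : 2 ≤ x0 + x1 + x2 := by
        by_contra hlt
        have : (x0 : ℚ) + x1 + x2 ≤ 1 := by exact_mod_cast (by omega : x0 + x1 + x2 ≤ 1)
        norm_num at hs
        rcases hs with hs | hs <;> linarith
      rcases (by omega : (x0 = 1 ∧ x1 = 1 ∧ x2 = 0 ∧ x3 = 0) ∨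
        (x0 = 2 ∧ x1 = 0 ∧ x2 = 0 ∧ x3 = 0)) with ⟨rfl, rfl, rfl, rfl⟩ | ⟨rfl, rfl, rfl, rfl⟩
      · right; left
        rw [← lw_append_zero [1, 1], ← lw_append_zero]
        apply eq_lw_of_four h <;> simp [e0, e1, e2, e3]
      · right; right; left
        rw [← lw_append_zero [2], ← lw_append_zero, ← lw_append_zero]
        apply eq_lw_of_four h <;> simp [e0, e1, e2, e3]
    · rcases (by omega : (x0 = 0 ∧ x1 = 0 ∧ x2 = 0 ∧ x3 = 0) ∨
        (x0 = 1 ∧ x1 = 0 ∧ x2 = 0 ∧ x3 = 0)) with ⟨rfl, rfl, rfl, rfl⟩ | ⟨rfl, rfl, rfl, rfl⟩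
      · left
        apply eq_lw_of_four h <;> simp [e0, e1, e2, e3]
      · norm_num at hle

theorem exists_eq_replicate_add {α : Type*} {A B C D : α} (S : Multiset α)
    (h : ∀ x ∈ S, x = A ∨ x = B ∨ x = C ∨ x = D) :
    ∃ a b c d : ℕ, S = Multiset.replicate a A + Multiset.replicate b B +
      Multiset.replicate c C + Multiset.replicate d D := by
  induction S using Multiset.induction_on with
  | empty => exact ⟨0, 0, 0, 0, by simp⟩
  | cons x S ih =>
    obtain ⟨a, b, c, d, rfl⟩ := ih fun y hy => h y (Multiset.mem_cons_of_mem hy)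
    rcases h x (Multiset.mem_cons_self _ _) with rfl | rfl | rfl | rfl
    · exact ⟨a + 1, b, c, d, by simp [Multiset.replicate_succ]⟩
    · exact ⟨a, b + 1, c, d, by simp [Multiset.replicate_succ]⟩
    · exact ⟨a, b, c + 1, d, by simp [Multiset.replicate_succ]⟩
    · exact ⟨a, b, c, d + 1, by simp [Multiset.replicate_succ]⟩

theorem classification_four (S : Multiset (ℕ → ℚ))
    (hw : ∀ β ∈ S, IsOGrOddWeight 4 β ∧ β ≠ 0 ∧ β ≠ lw [1])
    (hnew : ∃ β ∈ S, (∃ i, i < 4 ∧ ∀ z : ℤ, β i ≠ (z : ℚ)) ∨ β 3 ≠ 0)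
    (hr : (S.map (ogrOddRank 3 4)).sum = 8) (hd : (S.map (ogrOddDex 3 4)).sum = 5) :
    S = {lw [1/2, 1/2, 1/2, 1/2], lw [1/2, 1/2, 1/2, 1/2],
      lw [1/2, 1/2, 1/2, 1/2], lw [1, 1, 1], lw [1, 1, 1]} ∨
    S = {lw [1/2, 1/2, 1/2, 1/2], lw [1/2, 1/2, 1/2, 1/2], lw [1, 1], lw [1, 1, 1]} ∨
    S = {lw [1/2, 1/2, 1/2, 1/2], lw [1, 1], lw [1, 1]} ∨
    S = {lw [1/2, 1/2, 1/2, 1/2], lw [2]} := by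
  have hslope : ∀ β ∈ S, 0 < ogrOddRank 3 4 β ∧ (1 / 2 : ℚ) ≤ headSum 3 β / (3 : ℕ) := by
    intro β hβ
    obtain ⟨hβw, h0, h1⟩ := hw β hβ
    refine ⟨ogrOddRank_pos hβw, ?_⟩
    rcases le_headSum (m := 3) (by norm_num) hβw h0 h1 with h | h <;>
    · push_cast at h ⊢
      linarith
  have hcl : ∀ β ∈ S, β = lw [1/2, 1/2, 1/2, 1/2] ∨ β = lw [1, 1] ∨ β = lw [2] ∨
      β = lw [1, 1, 1] := by
    intro β hβ
    obtain ⟨hβw, h0, h1⟩ := hw β hβ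
    refine weight_four_classification hβw h0 h1 ?_
    obtain ⟨T, rfl⟩ := Multiset.exists_cons_of_mem hβ
    have := mul_sum_rank_le_sum_dex (m := 3) (n := 4) (1 / 2) T
      fun γ hγ => hslope γ (Multiset.mem_cons_of_mem hγ)
    simp only [Multiset.map_cons, Multiset.sum_cons] at hr hd
    linarith
  obtain ⟨a, b, c, d, rfl⟩ := exists_eq_replicate_add S hcl
  have ha : a ≠ 0 := by
    rintro rfl
    obtain ⟨β, hβ, hβn⟩ := hnew
    have hint : ∀ l : List ℤ, ∀ i, ∃ z : ℤ, lw (l.map (Int.cast : ℤ → ℚ)) i = z := by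
      intro l i
      refine ⟨l.getD i 0, ?_⟩
      have := List.getD_map (l := l) (d := 0) (n := i) (f := (Int.cast : ℤ → ℚ))
      simpa [lw] using this
    have i1 := hint [1, 1]
    have i2 := hint [2]
    have i3 := hint [1, 1, 1]
    simp only [List.map_cons, List.map_nil, Int.cast_one, Int.cast_ofNat] at i1 i2 i3
    simp only [Multiset.mem_add, Multiset.mem_replicate] at hβ
    rcases hβn with ⟨i, -, hi⟩ | h3
    · rcases hβ with ((⟨h, -⟩ | ⟨-, rfl⟩) | ⟨-, rfl⟩) | ⟨-, rfl⟩
      · exact h rfl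
      · exact (i1 i).elim fun z hz => hi z hz
      · exact (i2 i).elim fun z hz => hi z hz
      · exact (i3 i).elim fun z hz => hi z hz
    · rcases hβ with ((⟨h, -⟩ | ⟨-, rfl⟩) | ⟨-, rfl⟩) | ⟨-, rfl⟩
      · exact h rfl
      all_goals exact h3 (by simp [lw])
  simp only [Multiset.map_add, Multiset.map_replicate, Multiset.sum_add, Multiset.sum_replicate,
    ogrOddDex, headSum_three_s14, ogrOddRank_four, lw] at hr hd
  norm_num at hr hd
  have hr' : 2 * a + 3 * b + 6 * c + d = 8 := by
    have : (2 * a + 3 * b + 6 * c + d : ℚ) = 8 := by linarith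
    exact_mod_cast this
  have hd' : a + 2 * b + 4 * c + d = 5 := by
    have : (a + 2 * b + 4 * c + d : ℚ) = 5 := by linarith
    exact_mod_cast this
  rcases (by omega : (a = 3 ∧ b = 0 ∧ c = 0 ∧ d = 2) ∨ (a = 2 ∧ b = 1 ∧ c = 0 ∧ d = 1) ∨
    (a = 1 ∧ b = 2 ∧ c = 0 ∧ d = 0) ∨ (a = 1 ∧ b = 0 ∧ c = 1 ∧ d = 0)) with
    ⟨rfl, rfl, rfl, rfl⟩ | ⟨rfl, rfl, rfl, rfl⟩ | ⟨rfl, rfl, rfl, rfl⟩ | ⟨rfl, rfl, rfl, rfl⟩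
  · exact Or.inl rfl
  · exact Or.inr (Or.inl rfl)
  · exact Or.inr (Or.inr (Or.inl rfl))
  · exact Or.inr (Or.inr (Or.inr rfl))

theorem one_le_ogrOddRank_three {β : ℕ → ℚ} (h : IsOGrOddWeight 3 β) :
    1 ≤ ogrOddRank 2 3 β := by
  have h1 := h.2.1 0 1 (by norm_num) (by norm_num)
  have h2 := h.2.2.1 2 (by norm_num)
  rw [ogrOddRank_three]
  nlinarith

theorem classification_three (S : Multiset (ℕ → ℚ))
    (hw : ∀ β ∈ S, IsOGrOddWeight 3 β)
    (hnew : ∃ β ∈ S, (∃ i, i < 3 ∧ ∀ z : ℤ, β i ≠ (z : ℚ)) ∨ β 2 ≠ 0)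
    (hr : (S.map (ogrOddRank 2 3)).sum = 3) (hd : (S.map (ogrOddDex 2 3)).sum = 4) :
    S = {lw [1/2, 1/2, 1/2], lw [3, 3]} ∨ S = {lw [3/2, 3/2, 1/2], lw [1, 1]} := by
  obtain ⟨β, hβ, hβn⟩ := hnew
  obtain ⟨T, rfl⟩ := Multiset.exists_cons_of_mem hβ
  have hβw := hw β hβ
  simp only [Multiset.map_cons, Multiset.sum_cons] at hr hd
  obtain ⟨p, x, hp, hx, hanti, hnn⟩ := hβw.exists_int
  have e0 := hx 0 (by norm_num)
  have e1 := hx 1 (by norm_num)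
  have e2 := hx 2 (by norm_num)
  have a1 := hanti 0 1 (by norm_num) (by norm_num)
  have a2 := hanti 1 2 (by norm_num) (by norm_num)
  have a3 := hnn 2 (by norm_num)
  have hz : 1 ≤ 2 * x 2 + p := by
    by_contra hlt
    obtain ⟨hx2, rfl⟩ : x 2 = 0 ∧ p = 0 := by omega
    rcases hβn with ⟨i, hi, hiz⟩ | h2
    · exact hiz (x i) (by simpa using hx i hi)
    · exact h2 (by simp [e2, hx2])
  have hrβ : ogrOddRank 2 3 β = ((x 0 - x 1 + 1) * (2 * x 2 + p + 1) : ℤ) := by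
    rw [ogrOddRank_three, e0, e1, e2]
    push_cast
    ring
  have hdβ : ogrOddDex 2 3 β = (x 0 + x 1 + p) / 2 * ogrOddRank 2 3 β := by
    rw [ogrOddDex, headSum_two_s14, e0, e1]
    push_cast
    ring
  have hrβ2 : 2 ≤ (x 0 - x 1 + 1) * (2 * x 2 + p + 1) := by nlinarith
  have hβq : (2 : ℚ) ≤ ogrOddRank 2 3 β := by
    rw [hrβ]
    exact_mod_cast hrβ2
  induction T using Multiset.induction_on with
  | empty =>
    exfalso
    simp only [Multiset.map_zero, Multiset.sum_zero, add_zero] at hr hd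
    rw [hdβ, hr] at hd
    have : 3 * (x 0 + x 1 + p) = 8 := by
      have : (3 * (x 0 + x 1 + p) : ℚ) = 8 := by linarith
      exact_mod_cast this
    omega
  | cons γ U _ =>
    have hγw := hw γ (by simp)
    have hγ1 := one_le_ogrOddRank_three hγw
    simp only [Multiset.map_cons, Multiset.sum_cons] at hr hd
    have hU : U = 0 := by
      rcases U.empty_or_exists_mem with h | ⟨δ, hδ⟩
      · exact h
      · exfalso
        obtain ⟨V, rfl⟩ := Multiset.exists_cons_of_mem hδ
        have hδ1 := one_le_ogrOddRank_three (hw δ (by simp))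
        have hV : 0 ≤ (V.map (ogrOddRank 2 3)).sum := by
          refine Multiset.sum_nonneg fun q hq => ?_
          obtain ⟨ε, hε, rfl⟩ := Multiset.mem_map.1 hq
          exact (ogrOddRank_pos (m := 2) (hw ε (by simp [hε]))).le
        simp only [Multiset.map_cons, Multiset.sum_cons] at hr
        linarith
    subst hU
    simp only [Multiset.map_zero, Multiset.sum_zero, add_zero] at hr hd
    have hβr : ogrOddRank 2 3 β = 2 := by linarith
    have hγr : ogrOddRank 2 3 γ = 1 := by linarith
    obtain ⟨q, y, hq, hy, hyanti, hynn⟩ := hγw.exists_int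
    have f0 := hy 0 (by norm_num)
    have f1 := hy 1 (by norm_num)
    have f2 := hy 2 (by norm_num)
    have b1 := hyanti 0 1 (by norm_num) (by norm_num)
    have b2 := hyanti 1 2 (by norm_num) (by norm_num)
    have b3 := hynn 2 (by norm_num)
    have hdγ : ogrOddDex 2 3 γ = (y 0 + y 1 + q) / 2 * ogrOddRank 2 3 γ := by
      rw [ogrOddDex, headSum_two_s14, f0, f1]
      push_cast
      ring
    have hγr' : (y 0 - y 1 + 1) * (2 * y 2 + q + 1) = 1 := by
      rw [ogrOddRank_three, f0, f1, f2] at hγr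
      have : ((y 0 - y 1 + 1) * (2 * y 2 + q + 1) : ℚ) = 1 := by linarith
      exact_mod_cast this
    have hβr' : (x 0 - x 1 + 1) * (2 * x 2 + p + 1) = 2 := by
      rw [hrβ] at hβr
      exact_mod_cast hβr
    have hd' : 2 * (x 0 + x 1 + p) + (y 0 + y 1 + q) = 8 := by
      rw [hdβ, hdγ, hβr, hγr] at hd
      have : (2 * (x 0 + x 1 + p) + (y 0 + y 1 + q) : ℚ) = 8 := by linarith
      exact_mod_cast this
    have hx01 : x 0 = x 1 := by nlinarith
    have hq0 : 0 ≤ 2 * y 2 + q := by omega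
    have hy01 : y 0 = y 1 := by nlinarith
    have hx2 : 2 * x 2 + p = 1 := by
      rw [hx01] at hβr'
      linarith
    have hy2 : 2 * y 2 + q = 0 := by
      rw [hy01] at hγr'
      linarith
    obtain ⟨rfl, hx2, rfl, hy2⟩ : p = 1 ∧ x 2 = 0 ∧ q = 0 ∧ y 2 = 0 := by omega
    rcases (by omega : (x 1 = 0 ∧ y 1 = 3) ∨ (x 1 = 1 ∧ y 1 = 1)) with ⟨hx1, hy1⟩ | ⟨hx1, hy1⟩
    · left
      rw [hx1] at hx01
      rw [hy1] at hy01
      have hβe : β = lw [1/2, 1/2, 1/2] := by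
        apply eq_lw_of_three hβw <;> norm_num [*]
      have hγe : γ = lw [3, 3] := by
        rw [← lw_append_zero [3, 3]]
        apply eq_lw_of_three hγw <;> norm_num [*]
      rw [hβe, hγe]
      rfl
    · right
      rw [hx1] at hx01
      rw [hy1] at hy01
      have hβe : β = lw [3/2, 3/2, 1/2] := by
        apply eq_lw_of_three hβw <;> norm_num [*]
      have hγe : γ = lw [1, 1] := by
        rw [← lw_append_zero [1, 1]]
        apply eq_lw_of_three hγw <;> norm_num [*]
      rw [hβe, hγe]
      rfl

/-- Classification of fourfolds with trivial canonical bundle in the odd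
orthogonal Grassmannians `OGr(n−1,2n+1)`. -/
theorem stmt14 (n : ℕ) (hn : 2 ≤ n)
    (S : Multiset (ℕ → ℚ))
    (hw : ∀ β ∈ S, IsOGrOddWeight n β ∧ β ≠ 0 ∧ β ≠ lw [1])
    (hnew : ∃ β ∈ S, (∃ i, i < n ∧ ∀ z : ℤ, β i ≠ (z : ℚ)) ∨ β (n - 1) ≠ 0)
    (hr : (S.map (ogrOddRank (n - 1) n)).sum =
      ((n : ℚ) - 1) * ((n : ℚ) + 2) - (n : ℚ) * ((n : ℚ) - 1) / 2 - 4)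
    (hd : (S.map (ogrOddDex (n - 1) n)).sum = (n : ℚ) + 1) :
    (n = 3 ∧ S = {lw [1/2, 1/2, 1/2], lw [3, 3]}) ∨
    (n = 3 ∧ S = {lw [3/2, 3/2, 1/2], lw [1, 1]}) ∨
    (n = 4 ∧ S = {lw [1/2, 1/2, 1/2, 1/2], lw [1/2, 1/2, 1/2, 1/2],
      lw [1/2, 1/2, 1/2, 1/2], lw [1, 1, 1], lw [1, 1, 1]}) ∨
    (n = 4 ∧ S = {lw [1/2, 1/2, 1/2, 1/2], lw [1/2, 1/2, 1/2, 1/2],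
      lw [1, 1], lw [1, 1, 1]}) ∨
    (n = 4 ∧ S = {lw [1/2, 1/2, 1/2, 1/2], lw [1, 1], lw [1, 1]}) ∨
    (n = 4 ∧ S = {lw [1/2, 1/2, 1/2, 1/2], lw [2]}) := by
  
  obtain ⟨m, rfl⟩ : ∃ m, n = m + 1 := ⟨n - 1, by omega⟩
  simp only [Nat.add_sub_cancel] at hr hd hnew
  have hpos : ∀ β ∈ S, 0 < ogrOddRank m (m + 1) β := fun β hβ => ogrOddRank_pos (hw β hβ).1
  rcases (by omega : m = 1 ∨ m = 2 ∨ m = 3 ∨ 4 ≤ m) with rfl | rfl | rfl | hm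
  · exfalso
    have : 0 ≤ (S.map (ogrOddRank 1 (1 + 1))).sum := by
      refine Multiset.sum_nonneg fun q hq => ?_
      obtain ⟨β, hβ, rfl⟩ := Multiset.mem_map.1 hq
      exact (hpos β hβ).le
    rw [hr] at this
    norm_num at this
  · rcases classification_three S (fun β hβ => (hw β hβ).1) hnew
      (hr.trans (by norm_num)) (hd.trans (by norm_num)) with h | h
    · exact Or.inl ⟨rfl, h⟩
    · exact Or.inr (Or.inl ⟨rfl, h⟩)
  · have h := classification_four S hw hnew (hr.trans (by norm_num)) (hd.trans (by norm_num))
    rcases h with h | h | h | h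
    · exact Or.inr (Or.inr (Or.inl ⟨rfl, h⟩))
    · exact Or.inr (Or.inr (Or.inr (Or.inl ⟨rfl, h⟩)))
    · exact Or.inr (Or.inr (Or.inr (Or.inr (Or.inl ⟨rfl, h⟩))))
    · exact Or.inr (Or.inr (Or.inr (Or.inr (Or.inr ⟨rfl, h⟩))))
  · exfalso
    have hmq : (4 : ℚ) ≤ m := by exact_mod_cast hm
    have key := mul_sum_rank_le_sum_dex (m := m) (n := m + 1) (2 / m) S fun β hβ => by
      refine ⟨hpos β hβ, div_le_div_of_nonneg_right ?_ (by linarith)⟩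
      rcases le_headSum (by omega) (hw β hβ).1 (hw β hβ).2.1 (hw β hβ).2.2 with h | h <;> linarith
    rw [hr, hd, div_mul_eq_mul_div, div_le_iff₀ (by linarith)] at key
    push_cast at key
    nlinarith
end
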